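/- There exists a constant c > 0 such that for every prime p > 2, every generator h of the multiplicative group F_p^*, every quadratic polynomial g(x,y) ∈ F_p[x,y] with nonzero xy-coefficient, and every integer N with 1 ≤ N ≤ p^(4/7), the set {h^x + h^y + g(h^z, h^t) : x,y,z,t ∈ ℤ, 1 ≤ x,y,z,t ≤ N} has cardinality at least c·N^(7/4). -/

import Mathlib

open Finset
set_option linter.all false

section PartOne

variable {K : Type*} [Field K]

/-- Restriction of a polynomial in `(u,v,w)` to the null line of `q = (z,t,b)`. -/
noncomputable def rho (q : K × K × K) : MvPolynomial (Fin 3) K →ₐ[K] Polynomial K :=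
  MvPolynomial.aeval ![Polynomial.C (q.2.2 - q.2.1 * q.1) + Polynomial.C (q.1 ^ 2) * Polynomial.X,
    Polynomial.C q.2.1 - Polynomial.C q.1 * Polynomial.X, Polynomial.X]

lemma rho_natDegree_le (q : K × K × K) (f : MvPolynomial (Fin 3) K) :
    (rho q f).natDegree ≤ f.totalDegree := by
  have := MvPolynomial.aeval_natDegree_le f le_rfl
    ![Polynomial.C (q.2.2 - q.2.1 * q.1) + Polynomial.C (q.1 ^ 2) * Polynomial.X,
    Polynomial.C q.2.1 - Polynomial.C q.1 * Polynomial.X, Polynomial.X] (n := 1) (by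
      intro i
      fin_cases i
      · simp only [Fin.zero_eta, Fin.isValue, Matrix.cons_val_zero]
        compute_degree
      · simp only [Fin.mk_one, Fin.isValue, Matrix.cons_val_one, Matrix.cons_val_zero]
        compute_degree
      · simp)
  simpa [rho] using this

/-- directional derivative along the null direction -/
noncomputable def Dz (z : K) (f : MvPolynomial (Fin 3) K) : MvPolynomial (Fin 3) K :=
  MvPolynomial.C (z ^ 2) * MvPolynomial.pderiv 0 f - MvPolynomial.C z * MvPolynomial.pderiv 1 f
    + MvPolynomial.pderiv 2 f

lemma rho_X0 (q : K × K × K) : rho q (MvPolynomial.X 0) = Polynomial.C (q.2.2 - q.2.1 * q.1) + Polynomial.C (q.1 ^ 2) * Polynomial.X := by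
  simp [rho]
lemma rho_X1 (q : K × K × K) : rho q (MvPolynomial.X 1) = Polynomial.C q.2.1 - Polynomial.C q.1 * Polynomial.X := by
  simp [rho]
lemma rho_X2 (q : K × K × K) : rho q (MvPolynomial.X 2) = Polynomial.X := by
  simp [rho]
lemma rho_C (q : K × K × K) (a : K) : rho q (MvPolynomial.C a) = Polynomial.C a := by
  simp [rho]

lemma rho_deriv (q : K × K × K) (f : MvPolynomial (Fin 3) K) :
    Polynomial.derivative (rho q f) = rho q (Dz q.1 f) := by
  induction f using MvPolynomial.induction_on with
  | C a => simp [rho_C, Dz]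
  | add f g hf hg =>
    simp only [map_add, hf, hg, Dz, map_sub, map_mul]
    ring
  | mul_X f i hf =>
    rw [map_mul, Polynomial.derivative_mul, hf]
    have h0 : (MvPolynomial.pderiv i (MvPolynomial.X i : MvPolynomial (Fin 3) K)) = 1 := by simp
    fin_cases i
    · simp [Dz, MvPolynomial.pderiv_mul, rho_X0, rho_X1, rho_X2, rho_C,
        MvPolynomial.pderiv_X, Pi.single_apply, Polynomial.derivative_pow]
      ring
    · simp [Dz, MvPolynomial.pderiv_mul, rho_X0, rho_X1, rho_X2, rho_C,
        MvPolynomial.pderiv_X, Pi.single_apply]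
      ring
    · simp [Dz, MvPolynomial.pderiv_mul, rho_X0, rho_X1, rho_X2, rho_C,
        MvPolynomial.pderiv_X, Pi.single_apply]
      ring

lemma rho_eval (q : K × K × K) (f : MvPolynomial (Fin 3) K) (w : K) :
    (rho q f).eval w = MvPolynomial.eval
      ![q.2.2 - q.2.1 * q.1 + q.1 ^ 2 * w, q.2.1 - q.1 * w, w] f := by
  induction f using MvPolynomial.induction_on with
  | C a => simp [rho_C]
  | add f g hf hg => simp [hf, hg]
  | mul_X f i hf =>
    rw [map_mul, Polynomial.eval_mul, hf]
    fin_cases i <;> simp [rho_X0, rho_X1, rho_X2]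

lemma totalDegree_pderiv_le (i : Fin 3) (f : MvPolynomial (Fin 3) K) :
    (MvPolynomial.pderiv i f).totalDegree ≤ f.totalDegree - 1 := by
  classical
  rw [MvPolynomial.totalDegree, Finset.sup_le_iff]
  intro m hm
  rw [MvPolynomial.mem_support_iff, MvPolynomial.coeff_pderiv] at hm
  have h1 : m + Finsupp.single i 1 ∈ f.support := by
    rw [MvPolynomial.mem_support_iff]
    intro h; apply hm; rw [h, zero_mul]
  have h2 := MvPolynomial.le_totalDegree h1
  rw [Finsupp.sum_add_index' (by simp) (by simp), Finsupp.sum_single_index (by simp)] at h2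
  omega

/-- number of monomials -/
lemma finrank_restrict (k : ℕ) :
    Module.finrank K (MvPolynomial.restrictTotalDegree (Fin 3) K k) = (k + 3).choose 3 := by
  classical
  have hfin : {n : Fin 3 →₀ ℕ | (n.sum fun _ e => e) ≤ k} =
      (((Finset.range (k+1)).biUnion fun j => (Finset.univ : Finset (Fin 3)).finsuppAntidiag j : Finset (Fin 3 →₀ ℕ)) : Set (Fin 3 →₀ ℕ)) := by
    ext n
    simp only [Set.mem_setOf_eq, Finset.coe_biUnion, Set.mem_iUnion, Finset.mem_coe,
      Finset.mem_range, Finset.mem_finsuppAntidiag]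
    rw [Finsupp.sum_fintype _ _ (by simp)]
    simp [Nat.lt_succ_iff]
  have hb := Module.finrank_eq_nat_card_basis
    (MvPolynomial.basisRestrictSupport K {n : Fin 3 →₀ ℕ | (n.sum fun _ e => e) ≤ k})
  have : Module.finrank K (MvPolynomial.restrictTotalDegree (Fin 3) K k) =
    Nat.card {n : Fin 3 →₀ ℕ | (n.sum fun _ e => e) ≤ k} := hb
  rw [this, Nat.card_coe_set_eq, hfin, Set.ncard_coe_finset, Finset.card_biUnion]
  · simp only [Finset.card_finsuppAntidiag_nat_eq_choose, Finset.card_univ, Fintype.card_fin]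
    induction k with
    | zero => simp
    | succ k ih =>
      have h3 : (3 + (k + 1) - 1).choose (k+1) = (k + 3).choose 2 := by
        rw [← Nat.choose_symm_of_eq_add (n := k+3) (a := k+1) (b := 2) (by omega)]
        congr 1; omega
      have ih' : ∑ x ∈ Finset.range (k+1), (3 + x - 1).choose x = (k+3).choose 3 := by
        apply ih
        · ext n
          simp only [Set.mem_setOf_eq, Finset.coe_biUnion, Set.mem_iUnion, Finset.mem_coe,
            Finset.mem_range, Finset.mem_finsuppAntidiag]
          rw [Finsupp.sum_fintype _ _ (by simp)]
          simp [Nat.lt_succ_iff]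
        · exact Module.finrank_eq_nat_card_basis
            (MvPolynomial.basisRestrictSupport K {n : Fin 3 →₀ ℕ | (n.sum fun _ e => e) ≤ k})
        · exact Module.finrank_eq_nat_card_basis
            (MvPolynomial.basisRestrictSupport K {n : Fin 3 →₀ ℕ | (n.sum fun _ e => e) ≤ k})
      rw [Finset.sum_range_succ, ih', h3, show k + 1 + 3 = (k+3) + 1 by ring, Nat.choose_succ_succ' (k+3) 2]
      ring
  · intro i _ j _ hij
    rw [Function.onFun, Finset.disjoint_left]
    intro n hn hn'
    rw [Finset.mem_finsuppAntidiag] at hn hn'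
    exact hij (hn.1.symm.trans hn'.1)

lemma choose3 (k : ℕ) : 6 * (k + 3).choose 3 = (k+1)*(k+2)*(k+3) := by
  have := Nat.add_one_mul_choose_eq (k+2) 2
  have h2 := Nat.add_one_mul_choose_eq (k+1) 1
  simp only [Nat.succ_eq_add_one, Nat.choose_one_right] at this h2
  norm_num [add_assoc] at this h2
  nlinarith

end PartOne

section PartTwo

variable {K : Type*} [Field K]

lemma exists_vanishing [DecidableEq K] (Q : Finset (K × K × K)) (D : ℕ)
    (h : Q.card * (D + 1) < (D + 3).choose 3) :
    ∃ f : MvPolynomial (Fin 3) K, f ≠ 0 ∧ f.totalDegree ≤ D ∧ ∀ q ∈ Q, rho q f = 0 := by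
  let Λ : MvPolynomial.restrictTotalDegree (Fin 3) K D →ₗ[K] (Q → Fin (D+1) → K) :=
    LinearMap.pi fun q => LinearMap.pi fun i =>
      (Polynomial.lcoeff K (i : ℕ)) ∘ₗ (rho (q : K × K × K)).toLinearMap ∘ₗ
        (MvPolynomial.restrictTotalDegree (Fin 3) K D).subtype
  have hlt : Module.finrank K (Q → Fin (D+1) → K) <
      Module.finrank K (MvPolynomial.restrictTotalDegree (Fin 3) K D) := by
    rw [finrank_restrict, Module.finrank_pi_fintype]
    simpa using h
  have hk := LinearMap.ker_ne_bot_of_finrank_lt (f := Λ) hlt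
  obtain ⟨x, hx, hx0⟩ := Submodule.exists_mem_ne_zero_of_ne_bot hk
  refine ⟨x, by simpa using hx0, (MvPolynomial.mem_restrictTotalDegree _ _ _).1 x.2, ?_⟩
  intro q hq
  ext i
  by_cases hi : i < D + 1
  · have := congrFun (congrFun (LinearMap.mem_ker.1 hx) ⟨q, hq⟩) ⟨i, hi⟩
    simpa [Λ] using this
  · rw [Polynomial.coeff_eq_zero_of_natDegree_lt]
    · simp
    · have h1 := rho_natDegree_le q (x : MvPolynomial (Fin 3) K)
      have h2 := (MvPolynomial.mem_restrictTotalDegree _ _ _).1 x.2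
      omega

lemma exists_sep (q q' : K × K × K) (h : q ≠ q') : ∃ g : MvPolynomial (Fin 3) K,
    g.totalDegree ≤ 1 ∧ rho q' g = 0 ∧ rho q g ≠ 0 := by
  by_contra hcon
  push Not at hcon
  have hX : ∀ i : Fin 3, (MvPolynomial.X i : MvPolynomial (Fin 3) K).totalDegree ≤ 1 := by
    intro i; simp
  have d1 : (MvPolynomial.X 0 + MvPolynomial.C q'.1 * MvPolynomial.X 1 - MvPolynomial.C q'.2.2 :
      MvPolynomial (Fin 3) K).totalDegree ≤ 1 := by
    refine (MvPolynomial.totalDegree_sub _ _).trans (max_le ((MvPolynomial.totalDegree_add _ _).trans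
      (max_le (hX 0) ((MvPolynomial.totalDegree_mul _ _).trans ?_))) (by simp))
    simp
  have d2 : (MvPolynomial.X 1 + MvPolynomial.C q'.1 * MvPolynomial.X 2 - MvPolynomial.C q'.2.1 :
      MvPolynomial (Fin 3) K).totalDegree ≤ 1 := by
    refine (MvPolynomial.totalDegree_sub _ _).trans (max_le ((MvPolynomial.totalDegree_add _ _).trans
      (max_le (hX 1) ((MvPolynomial.totalDegree_mul _ _).trans ?_))) (by simp))
    simp
  have e1 := hcon _ d1 (by
    simp only [map_add, map_sub, map_mul, rho_X0, rho_X1, rho_X2, rho_C, map_pow]; ring)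
  have e2 := hcon _ d2 (by
    simp only [map_add, map_sub, map_mul, rho_X0, rho_X1, rho_X2, rho_C, map_pow]; ring)
  simp only [map_add, map_sub, map_mul, rho_X0, rho_X1, rho_X2, rho_C, map_pow] at e1 e2
  have a1 := congrArg (Polynomial.eval 0) e2
  have a2 := congrArg (Polynomial.eval 1) e2
  have a3 := congrArg (Polynomial.eval 0) e1
  simp at a1 a2 a3
  apply h
  have ht : q.2.1 = q'.2.1 := sub_eq_zero.1 a1
  have hz : q.1 = q'.1 := by linear_combination a1 - a2
  have hb : q.2.2 = q'.2.2 := by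
    rw [ht, hz] at a3
    linear_combination a3
  exact Prod.ext hz (Prod.ext ht hb)

lemma bezout_arith (n d e r : ℕ) (hr : r = d * e * (n + d + e + 2) + 1)
    (h : n * r + ((n + r + e + 3).choose 3 + (n + r + d + 3).choose 3) ≤
      (n + r + d + e + 3).choose 3 + (n + r + 3).choose 3) : n ≤ d * e := by
  by_contra hn
  push Not at hn
  have c1 := choose3 (n + r + e)
  have c2 := choose3 (n + r + d)
  have c3 := choose3 (n + r + d + e)
  have c4 := choose3 (n + r)
  have h6 : 6 * (n * r) + ((n+r+e+1)*(n+r+e+2)*(n+r+e+3) + (n+r+d+1)*(n+r+d+2)*(n+r+d+3)) ≤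
    (n+r+d+e+1)*(n+r+d+e+2)*(n+r+d+e+3) + (n+r+1)*(n+r+2)*(n+r+3) := by
    rw [← c1, ← c2, ← c3, ← c4]; omega
  have h7 : 6 * (n * r) ≤ 3 * (d * e) * (2 * (n + r) + d + e + 4) := by
    zify at h6 ⊢
    nlinarith [h6]
  have h8 : (d * e + 1) * r ≤ n * r := Nat.mul_le_mul_right _ hn
  have h9 : r ≤ d * e * (n + d + e + 2) := by
    zify at h7 h8 ⊢
    have : (0:ℤ) ≤ (d:ℤ) * e * (d + e) := by positivity
    nlinarith
  omega

lemma bezout_lines [DecidableEq K] (f H : MvPolynomial (Fin 3) K) (hf : Irreducible f) (hfH : ¬ f ∣ H)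
    (Q : Finset (K × K × K)) (h1 : ∀ q ∈ Q, rho q f = 0) (h2 : ∀ q ∈ Q, rho q H = 0) :
    Q.card ≤ f.totalDegree * H.totalDegree := by
  classical
  set d := f.totalDegree with hd
  set e := H.totalDegree with he
  set n := Q.card with hn
  have hH0 : H ≠ 0 := by rintro rfl; exact hfH (dvd_zero _)
  have hf0 : f ≠ 0 := hf.ne_zero
  obtain ⟨r, hr⟩ : ∃ r, r = d * e * (n + d + e + 2) + 1 := ⟨_, rfl⟩
  apply bezout_arith n d e r hr
  choose! g hg1 hg2 hg3 using fun (q q' : K × K × K) (h : q ≠ q') => exists_sep q q' h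
  let hh : K × K × K → MvPolynomial (Fin 3) K := fun q => ∏ q' ∈ Q.erase q, g q q'
  have hh_deg : ∀ q ∈ Q, (hh q).totalDegree ≤ n := by
    intro q hq
    refine (MvPolynomial.totalDegree_finset_prod _ _).trans ?_
    refine (Finset.sum_le_card_nsmul _ _ 1 ?_).trans ?_
    · intro q' hq'
      exact hg1 _ _ (Finset.ne_of_mem_erase hq').symm
    · simp [Finset.card_erase_of_mem hq, hn]
  have hh_van : ∀ q ∈ Q, ∀ q' ∈ Q, q ≠ q' → rho q' (hh q) = 0 := by
    intro q hq q' hq' hne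
    simp only [hh, map_prod]
    exact Finset.prod_eq_zero (Finset.mem_erase.2 ⟨hne.symm, hq'⟩) (hg2 _ _ hne)
  have hh_non : ∀ q ∈ Q, rho q (hh q) ≠ 0 := by
    intro q hq
    simp only [hh, map_prod]
    rw [Finset.prod_ne_zero_iff]
    intro q' hq'
    exact hg3 _ _ (Finset.ne_of_mem_erase hq').symm
  let Θ : (Q → Fin r → K) →ₗ[K] MvPolynomial (Fin 3) K :=
    ∑ q : Q, ∑ i : Fin r,
      (LinearMap.toSpanSingleton K _ (MvPolynomial.X 2 ^ (i : ℕ) * hh q)) ∘ₗ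
        (LinearMap.proj i) ∘ₗ (LinearMap.proj q)
  have Θ_apply : ∀ p, Θ p = ∑ q : Q, ∑ i : Fin r, p q i • (MvPolynomial.X 2 ^ (i : ℕ) * hh q) := by
    intro p; simp [Θ, LinearMap.sum_apply]
  let V := fun k => MvPolynomial.restrictTotalDegree (Fin 3) K k
  have memV : ∀ k x, x ∈ V k ↔ x.totalDegree ≤ k := fun k x => MvPolynomial.mem_restrictTotalDegree _ _ _
  let LamPre : (Q → Fin r → K) × (V (n + r + e) × V (n + r + d)) →ₗ[K] MvPolynomial (Fin 3) K :=
    LinearMap.coprod Θ (LinearMap.coprod ((LinearMap.mulLeft K f) ∘ₗ (V (n+r+e)).subtype)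
      ((LinearMap.mulLeft K H) ∘ₗ (V (n+r+d)).subtype))
  have LamPre_apply : ∀ p x y, LamPre (p, (x, y)) = Θ p + (f * x + H * y) := by
    intro p x y; simp [LamPre]
  have LamPre_mem : ∀ a, LamPre a ∈ V (n + r + d + e) := by
    rintro ⟨p, x, y⟩
    rw [LamPre_apply]
    refine Submodule.add_mem _ ?_ (Submodule.add_mem _ ?_ ?_)
    · rw [Θ_apply]
      refine Submodule.sum_mem _ fun q _ => Submodule.sum_mem _ fun i _ => Submodule.smul_mem _ _ ?_
      rw [memV]
      refine (MvPolynomial.totalDegree_mul _ _).trans ?_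
      have := hh_deg q q.2
      have h3 := MvPolynomial.totalDegree_pow (MvPolynomial.X 2 : MvPolynomial (Fin 3) K) (i : ℕ)
      rw [MvPolynomial.totalDegree_X] at h3
      have := i.2
      omega
    · rw [memV]
      refine (MvPolynomial.totalDegree_mul _ _).trans ?_
      have := (memV _ _).1 x.2
      omega
    · rw [memV]
      refine (MvPolynomial.totalDegree_mul _ _).trans ?_
      have := (memV _ _).1 y.2
      omega
  let Λ := LinearMap.codRestrict (V (n+r+d+e)) LamPre LamPre_mem
  -- kernel
  let Γ : V (n + r) →ₗ[K] (Q → Fin r → K) × (V (n + r + e) × V (n + r + d)) :=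
    LinearMap.prod 0 (LinearMap.prod
      (LinearMap.codRestrict _ ((LinearMap.mulLeft K H) ∘ₗ (V (n+r)).subtype) (by
        intro c
        rw [memV]
        refine (MvPolynomial.totalDegree_mul _ _).trans ?_
        have := (memV _ _).1 c.2
        simp only [Submodule.subtype_apply]
        omega))
      (LinearMap.codRestrict _ ((LinearMap.mulLeft K (-f)) ∘ₗ (V (n+r)).subtype) (by
        intro c
        rw [memV]
        refine (MvPolynomial.totalDegree_mul _ _).trans ?_
        have := (memV _ _).1 c.2
        simp only [Submodule.subtype_apply, MvPolynomial.totalDegree_neg]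
        omega)))
  have hker : LinearMap.ker Λ ≤ LinearMap.range Γ := by
    rintro ⟨p, x, y⟩ hp
    have hp0 : Θ p + (f * x + H * y) = 0 := by
      rw [← LamPre_apply]
      exact congrArg Subtype.val (LinearMap.mem_ker.1 hp)
    have hp1 : p = 0 := by
      funext q
      have h3 := congrArg (rho (q : K × K × K)) hp0
      rw [map_add, map_add, map_mul, map_mul, h1 q q.2, h2 q q.2, Θ_apply] at h3
      simp only [map_sum, map_smul, map_mul, map_pow, rho_X2, zero_mul, add_zero, map_zero] at h3
      rw [Finset.sum_eq_single q] at h3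
      · have h4 : (∑ i : Fin r, Polynomial.C (p q i) * Polynomial.X ^ (i : ℕ)) * rho q (hh q) = 0 := by
          rw [← h3, Finset.sum_mul]
          refine Finset.sum_congr rfl fun i _ => ?_
          rw [Polynomial.smul_eq_C_mul, mul_assoc]
        have h5 := (mul_eq_zero.1 h4).resolve_right (hh_non q q.2)
        funext i
        have h6 := congrArg (fun P => Polynomial.coeff P (i : ℕ)) h5
        simp only [Polynomial.finset_sum_coeff, Polynomial.coeff_C_mul_X_pow, Polynomial.coeff_zero] at h6
        rw [Finset.sum_eq_single i] at h6
        · simpa using h6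
        · intro b _ hb
          rw [if_neg]
          intro hc; exact hb (Fin.ext hc.symm)
        · simp
      · intro b _ hb
        have hb' : (b : K × K × K) ≠ q := fun hc => hb (Subtype.ext hc)
        simp [hh_van b b.2 q q.2 hb']
      · simp
    rw [hp1, map_zero, zero_add] at hp0
    have hdvd : f ∣ H * (y : MvPolynomial (Fin 3) K) := ⟨-x, by linear_combination hp0⟩
    obtain ⟨c, hc⟩ := (hf.prime.dvd_or_dvd hdvd).resolve_left hfH
    have hx : (x : MvPolynomial (Fin 3) K) = H * (-c) := by
      have : f * ((x : MvPolynomial (Fin 3) K) + H * c) = 0 := by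
        rw [hc] at hp0; linear_combination hp0
      have := (mul_eq_zero.1 this).resolve_left hf0
      linear_combination this
    have hcdeg : (-c) ∈ V (n + r) := by
      rw [memV, MvPolynomial.totalDegree_neg]
      by_cases hc0 : c = 0
      · simp [hc0]
      · have h3 := (memV _ _).1 y.2
        rw [hc, MvPolynomial.totalDegree_mul_of_isDomain hf0 hc0] at h3
        omega
    refine ⟨⟨-c, hcdeg⟩, ?_⟩
    refine Prod.ext ?_ (Prod.ext ?_ ?_)
    · simp [Γ, hp1]
    · apply Subtype.ext; simp [Γ, hx]
    · apply Subtype.ext; simp [Γ, hc]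
  have hrn := LinearMap.finrank_range_add_finrank_ker Λ
  have hb1 : Module.finrank K (LinearMap.range Λ) ≤ (n + r + d + e + 3).choose 3 := by
    rw [← finrank_restrict (K := K)]; exact Submodule.finrank_le _
  have hb2 : Module.finrank K (LinearMap.ker Λ) ≤ (n + r + 3).choose 3 := by
    rw [← finrank_restrict (K := K)]
    exact (Submodule.finrank_mono hker).trans (LinearMap.finrank_range_le Γ)
  have hb3 : Module.finrank K ((Q → Fin r → K) × (V (n + r + e) × V (n + r + d))) =
      n * r + ((n + r + e + 3).choose 3 + (n + r + d + 3).choose 3) := by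
    rw [Module.finrank_prod, Module.finrank_prod, finrank_restrict, finrank_restrict,
      Module.finrank_pi_fintype]
    simp [hn]
  omega

end PartTwo

section PartThree

variable {K : Type*} [Field K]

def meet (q q' : K × K × K) : Prop :=
  q.1 ≠ q'.1 ∧ q.2.2 - q'.2.2 = q.1 * q'.2.1 - q'.1 * q.2.1

def mw (q q' : K × K × K) : K := (q.2.1 - q'.2.1) / (q.1 - q'.1)

lemma meet_symm {q q' : K × K × K} (h : meet q q') : meet q' q :=
  ⟨h.1.symm, by linear_combination -h.2⟩

lemma mw_symm (q q' : K × K × K) : mw q q' = mw q' q := by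
  unfold mw
  rw [← neg_sub q'.2.1, ← neg_sub q'.1, neg_div_neg_eq]

lemma mw_mul {q q' : K × K × K} (h : meet q q') : mw q q' * (q.1 - q'.1) = q.2.1 - q'.2.1 := by
  unfold mw
  exact div_mul_cancel₀ _ (sub_ne_zero.2 h.1)

lemma meet_eval {q q' : K × K × K} (h : meet q q') (f : MvPolynomial (Fin 3) K) :
    (rho q f).eval (mw q q') = (rho q' f).eval (mw q q') := by
  rw [rho_eval, rho_eval]
  have hw := mw_mul h
  have h2 := h.2
  have e1 : q.2.1 - q.1 * mw q q' = q'.2.1 - q'.1 * mw q q' := by linear_combination -hw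
  have e2 : q.2.2 - q.2.1 * q.1 + q.1 ^ 2 * mw q q' = q'.2.2 - q'.2.1 * q'.1 + q'.1 ^ 2 * mw q q' := by
    linear_combination h2 + (q.1 + q'.1) * hw
  rw [e1, e2]

lemma pderiv_comm' (i j : Fin 3) (f : MvPolynomial (Fin 3) K) :
    MvPolynomial.pderiv i (MvPolynomial.pderiv j f) = MvPolynomial.pderiv j (MvPolynomial.pderiv i f) := by
  have : ⁅(MvPolynomial.pderiv i : Derivation K (MvPolynomial (Fin 3) K) (MvPolynomial (Fin 3) K)),
      (MvPolynomial.pderiv j : Derivation K (MvPolynomial (Fin 3) K) (MvPolynomial (Fin 3) K))⁆ = 0 := by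
    apply MvPolynomial.derivation_ext
    intro k
    rw [Derivation.commutator_apply]
    simp [MvPolynomial.pderiv_X, Pi.single_apply, apply_ite]
  have h := congrArg (fun D => D f) this
  simpa [Derivation.commutator_apply, sub_eq_zero] using h

lemma Dz_pderiv (z : K) (i : Fin 3) (f : MvPolynomial (Fin 3) K) :
    MvPolynomial.pderiv i (Dz z f) = Dz z (MvPolynomial.pderiv i f) := by
  simp only [Dz, map_add, map_sub, MvPolynomial.pderiv_mul, MvPolynomial.pderiv_C, zero_mul, zero_add]
  rw [pderiv_comm' i 0, pderiv_comm' i 1, pderiv_comm' i 2]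

lemma wronski {p : ℕ} [CharP K p] (A B : Polynomial K) (hB : B ≠ 0)
    (hA : A.natDegree < p) (hBd : B.natDegree < p)
    (h : Polynomial.derivative A * B = A * Polynomial.derivative B) :
    ∃ c : K, A = Polynomial.C c * B := by
  have key : ∀ A : Polynomial K, A ≠ 0 → A.natDegree < p →
      Polynomial.derivative A * B = A * Polynomial.derivative B → A.natDegree = B.natDegree := by
    intro A hA0 hA h
    have lc : ∀ P : Polynomial K, (Polynomial.X * Polynomial.derivative P).coeff P.natDegree
        = P.natDegree * P.leadingCoeff := by
      intro P
      rcases Nat.eq_zero_or_pos P.natDegree with h0 | h0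
      · simp [h0]
      · obtain ⟨m, hm⟩ := Nat.exists_eq_succ_of_ne_zero h0.ne'
        rw [Polynomial.leadingCoeff, hm, Nat.succ_eq_add_one, Polynomial.coeff_X_mul, Polynomial.coeff_derivative]
        push_cast; ring
    have ld : ∀ P : Polynomial K, (Polynomial.X * Polynomial.derivative P).natDegree ≤ P.natDegree := by
      intro P
      rcases Nat.eq_zero_or_pos P.natDegree with h0 | h0
      · rw [Polynomial.derivative_of_natDegree_zero h0]; simp
      · refine Polynomial.natDegree_mul_le.trans ?_
        have := Polynomial.natDegree_derivative_le P
        rw [Polynomial.natDegree_X]; omega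
    have h2 : (Polynomial.X * Polynomial.derivative A) * B = A * (Polynomial.X * Polynomial.derivative B) := by
      linear_combination Polynomial.X * h
    have h3 := congrArg (fun P => P.coeff (A.natDegree + B.natDegree)) h2
    rw [Polynomial.coeff_mul_add_eq_of_natDegree_le (ld A) le_rfl,
      Polynomial.coeff_mul_add_eq_of_natDegree_le le_rfl (ld B), lc, lc] at h3
    have hla := Polynomial.leadingCoeff_ne_zero.2 hA0
    have hlb := Polynomial.leadingCoeff_ne_zero.2 hB
    have h4 : ((A.natDegree : K) - B.natDegree) * (A.leadingCoeff * B.leadingCoeff) = 0 := by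
      have e1 : A.coeff A.natDegree = A.leadingCoeff := rfl
      have e2 : B.coeff B.natDegree = B.leadingCoeff := rfl
      rw [e1, e2] at h3
      linear_combination h3
    have h5 := (mul_eq_zero.1 h4).resolve_right (mul_ne_zero hla hlb)
    have h6 : (A.natDegree : K) = B.natDegree := sub_eq_zero.1 h5
    exact CharP.natCast_injOn_Iio K p (Set.mem_Iio.2 hA) (Set.mem_Iio.2 hBd) h6
  by_cases hA0 : A = 0
  · exact ⟨0, by simp [hA0]⟩
  have hd := key A hA0 hA h
  refine ⟨A.leadingCoeff / B.leadingCoeff, ?_⟩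
  set c := A.leadingCoeff / B.leadingCoeff with hc
  by_contra hne
  have hlb := Polynomial.leadingCoeff_ne_zero.2 hB
  have hla := Polynomial.leadingCoeff_ne_zero.2 hA0
  have hc0 : c ≠ 0 := div_ne_zero hla hlb
  have hlt : (A - Polynomial.C c * B).degree < A.degree := by
    apply Polynomial.degree_sub_lt _ hA0
    · rw [Polynomial.leadingCoeff_mul, Polynomial.leadingCoeff_C, hc, div_mul_cancel₀ _ hlb]
    · rw [Polynomial.degree_C_mul hc0, Polynomial.degree_eq_natDegree hA0, Polynomial.degree_eq_natDegree hB, hd]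
  have hlt' := Polynomial.natDegree_lt_natDegree (sub_ne_zero.2 hne) hlt
  have := key (A - Polynomial.C c * B) (sub_ne_zero.2 hne) (by omega) (by
    simp only [Polynomial.derivative_sub, Polynomial.derivative_mul, Polynomial.derivative_C]
    linear_combination h)
  omega

lemma exists_pderiv_ne {p : ℕ} [CharP K p] (f : MvPolynomial (Fin 3) K) (h1 : 1 ≤ f.totalDegree)
    (hp : f.totalDegree < p) : ∃ i, MvPolynomial.pderiv i f ≠ 0 := by
  by_contra hcon
  push Not at hcon
  have : f.totalDegree = 0 := by
    rw [← Nat.le_zero, MvPolynomial.totalDegree, Finset.sup_le_iff]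
    intro m hm
    rw [Nat.le_zero, Finsupp.sum_fintype _ _ (by simp)]
    apply Finset.sum_eq_zero
    intro i _
    by_contra hmi
    have h2 := congrArg (MvPolynomial.coeff (m - Finsupp.single i 1)) (hcon i)
    have h3 : m - Finsupp.single i 1 + Finsupp.single i 1 = m := by
      apply tsub_add_cancel_of_le
      rw [Finsupp.single_le_iff]; omega
    rw [MvPolynomial.coeff_pderiv, h3, MvPolynomial.coeff_zero] at h2
    have h4 := (mul_eq_zero.1 h2).resolve_left (MvPolynomial.mem_support_iff.1 hm)
    have h5 : ((m i : ℕ) : K) = 0 := by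
      have : (m - Finsupp.single i 1 : Fin 3 →₀ ℕ) i = m i - 1 := by simp
      rw [this] at h4
      rw [← h4]
      have h6 : m i = (m i - 1) + 1 := by omega
      conv_lhs => rw [h6]
      push_cast; ring
    rw [CharP.cast_eq_zero_iff K p] at h5
    have h6 := Nat.le_of_dvd (by omega) h5
    have h7 := MvPolynomial.le_totalDegree hm
    rw [Finsupp.sum_fintype _ _ (by simp)] at h7
    have h8 := Finset.single_le_sum (f := fun i => m i) (fun i _ => Nat.zero_le _) (Finset.mem_univ i)
    omega
  omega

lemma irred_deg (f : MvPolynomial (Fin 3) K) (hf : Irreducible f) : 1 ≤ f.totalDegree := by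
  by_contra h
  have h0 : f.totalDegree = 0 := by omega
  have := MvPolynomial.totalDegree_eq_zero_iff_eq_C.1 h0
  apply hf.not_isUnit
  rw [this]
  apply IsUnit.map
  rw [isUnit_iff_ne_zero]
  intro h2
  rw [h2] at this
  exact hf.ne_zero (by simpa using this)

lemma not_dvd_of_deg (f g : MvPolynomial (Fin 3) K) (hg : g ≠ 0) (h : g.totalDegree < f.totalDegree) :
    ¬ f ∣ g := by
  rintro ⟨c, rfl⟩
  rw [MvPolynomial.totalDegree_mul_of_isDomain (left_ne_zero_of_mul hg) (right_ne_zero_of_mul hg)] at h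
  omega

end PartThree

section PartThreeB

variable {K : Type*} [Field K]

lemma Dz_Dz (z : K) (f : MvPolynomial (Fin 3) K) :
    Dz z (Dz z f) = MvPolynomial.C z ^ 4 * MvPolynomial.pderiv 0 (MvPolynomial.pderiv 0 f)
      - 2 * MvPolynomial.C z ^ 3 * MvPolynomial.pderiv 0 (MvPolynomial.pderiv 1 f)
      + MvPolynomial.C z ^ 2 * (MvPolynomial.pderiv 1 (MvPolynomial.pderiv 1 f)
        + 2 * MvPolynomial.pderiv 0 (MvPolynomial.pderiv 2 f))
      - 2 * MvPolynomial.C z * MvPolynomial.pderiv 1 (MvPolynomial.pderiv 2 f)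
      + MvPolynomial.pderiv 2 (MvPolynomial.pderiv 2 f) := by
  simp only [Dz, map_add, map_sub, MvPolynomial.pderiv_mul, MvPolynomial.pderiv_C, zero_mul, zero_add, map_pow]
  rw [pderiv_comm' 1 0, pderiv_comm' 2 0, pderiv_comm' 2 1]
  simp only [← map_pow, MvPolynomial.pderiv_C]
  simp only [map_pow]
  ring

lemma Dz_vanish (q : K × K × K) (f : MvPolynomial (Fin 3) K) (h : rho q f = 0) :
    rho q (Dz q.1 f) = 0 := by rw [← rho_deriv, h]; simp

/-- abstract two-root elimination -/
lemma two_roots {z0 z1 a b c e0 e1 e2 e3 e4 : K} (hz : z0 ≠ z1)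
    (h0 : a * z0 ^ 2 + b * z0 + c = 0) (h1 : a * z1 ^ 2 + b * z1 + c = 0)
    (g0 : e4 * z0 ^ 4 + e3 * z0 ^ 3 + e2 * z0 ^ 2 + e1 * z0 + e0 = 0)
    (g1 : e4 * z1 ^ 4 + e3 * z1 ^ 3 + e2 * z1 ^ 2 + e1 * z1 + e0 = 0) :
    (a ^ 3 * e1 - c * (a ^ 2 * e3 - a * b * e4)
      - b * (a ^ 2 * e2 - a * c * e4 - b * (a * e3 - b * e4)) = 0) ∧
    a ^ 3 * e0 - c * (a ^ 2 * e2 - a * c * e4 - b * (a * e3 - b * e4)) = 0 := by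
  have L : ∀ z, a * z ^ 2 + b * z + c = 0 → e4 * z ^ 4 + e3 * z ^ 3 + e2 * z ^ 2 + e1 * z + e0 = 0 →
    (a ^ 3 * e1 - c * (a ^ 2 * e3 - a * b * e4)
      - b * (a ^ 2 * e2 - a * c * e4 - b * (a * e3 - b * e4))) * z +
    (a ^ 3 * e0 - c * (a ^ 2 * e2 - a * c * e4 - b * (a * e3 - b * e4))) = 0 := by
    intro z h g
    linear_combination a ^ 3 * g - (a ^ 2 * e4 * z ^ 2 + (a ^ 2 * e3 - a * b * e4) * z
      + (a ^ 2 * e2 - a * c * e4 - b * (a * e3 - b * e4))) * h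
  have l0 := L z0 h0 g0
  have l1 := L z1 h1 g1
  have hR1 : (a ^ 3 * e1 - c * (a ^ 2 * e3 - a * b * e4)
      - b * (a ^ 2 * e2 - a * c * e4 - b * (a * e3 - b * e4))) = 0 := by
    apply (mul_eq_zero.1 (show (z0 - z1) * _ = 0 by linear_combination l0 - l1)).resolve_left
    exact sub_ne_zero.2 hz
  refine ⟨hR1, ?_⟩
  rw [hR1] at l0
  linear_combination l0

end PartThreeB

section PartThreeC

variable {K : Type*} [Field K]

open MvPolynomial in
lemma root_one (f : MvPolynomial (Fin 3) K) (q : K × K × K) (h : rho q f = 0) (w : K) :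
    (rho q (pderiv 0 f)).eval w * q.1 ^ 2 + (-(rho q (pderiv 1 f)).eval w) * q.1
      + (rho q (pderiv 2 f)).eval w = 0 := by
  have h1 := congrArg (Polynomial.eval w) (Dz_vanish q f h)
  simp only [Dz, map_add, map_sub, map_mul, rho_C, Polynomial.eval_add, Polynomial.eval_sub,
    Polynomial.eval_mul, Polynomial.eval_C, Polynomial.eval_zero] at h1
  linear_combination h1

open MvPolynomial in
lemma root_two (f : MvPolynomial (Fin 3) K) (q : K × K × K) (h : rho q f = 0) (w : K) :
    (rho q (pderiv 0 (pderiv 0 f))).eval w * q.1 ^ 4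
      + (-2 * (rho q (pderiv 0 (pderiv 1 f))).eval w) * q.1 ^ 3
      + ((rho q (pderiv 1 (pderiv 1 f))).eval w + 2 * (rho q (pderiv 0 (pderiv 2 f))).eval w) * q.1 ^ 2
      + (-2 * (rho q (pderiv 1 (pderiv 2 f))).eval w) * q.1
      + (rho q (pderiv 2 (pderiv 2 f))).eval w = 0 := by
  have h1 := congrArg (Polynomial.eval w) (Dz_vanish q _ (Dz_vanish q f h))
  rw [Dz_Dz] at h1
  simp only [map_add, map_sub, map_mul, map_pow, rho_C, Polynomial.eval_add, Polynomial.eval_sub,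
    Polynomial.eval_mul, Polynomial.eval_C, Polynomial.eval_zero, Polynomial.eval_pow, map_ofNat,
    Polynomial.eval_ofNat] at h1
  linear_combination h1

open MvPolynomial in
noncomputable def RR1 (f : MvPolynomial (Fin 3) K) : MvPolynomial (Fin 3) K :=
  (pderiv 0 f) ^ 3 * (-2 * pderiv 1 (pderiv 2 f))
  - pderiv 2 f * ((pderiv 0 f) ^ 2 * (-2 * pderiv 0 (pderiv 1 f)) - pderiv 0 f * (-pderiv 1 f) * pderiv 0 (pderiv 0 f))
  - (-pderiv 1 f) * ((pderiv 0 f) ^ 2 * (pderiv 1 (pderiv 1 f) + 2 * pderiv 0 (pderiv 2 f))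
    - pderiv 0 f * pderiv 2 f * pderiv 0 (pderiv 0 f)
    - (-pderiv 1 f) * (pderiv 0 f * (-2 * pderiv 0 (pderiv 1 f)) - (-pderiv 1 f) * pderiv 0 (pderiv 0 f)))

open MvPolynomial in
noncomputable def RR0 (f : MvPolynomial (Fin 3) K) : MvPolynomial (Fin 3) K :=
  (pderiv 0 f) ^ 3 * pderiv 2 (pderiv 2 f)
  - pderiv 2 f * ((pderiv 0 f) ^ 2 * (pderiv 1 (pderiv 1 f) + 2 * pderiv 0 (pderiv 2 f))
    - pderiv 0 f * pderiv 2 f * pderiv 0 (pderiv 0 f)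
    - (-pderiv 1 f) * (pderiv 0 f * (-2 * pderiv 0 (pderiv 1 f)) - (-pderiv 1 f) * pderiv 0 (pderiv 0 f)))

lemma RR_cross (f : MvPolynomial (Fin 3) K) (q q' : K × K × K) (h : rho q f = 0) (h' : rho q' f = 0)
    (hm : meet q q') : (rho q (RR1 f)).eval (mw q q') = 0 ∧ (rho q (RR0 f)).eval (mw q q') = 0 := by
  have a0 := root_one f q h (mw q q')
  have a1 := root_one f q' h' (mw q q')
  have b0 := root_two f q h (mw q q')
  have b1 := root_two f q' h' (mw q q')
  simp only [← meet_eval hm] at a1 b1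
  have := two_roots hm.1 a0 a1 b0 b1
  simp only [RR1, RR0, map_add, map_sub, map_mul, map_pow, map_neg, Polynomial.eval_add, Polynomial.eval_sub,
    Polynomial.eval_mul, Polynomial.eval_neg, Polynomial.eval_pow, map_ofNat,
    Polynomial.eval_ofNat]
  exact this

open MvPolynomial in
noncomputable def disc (f : MvPolynomial (Fin 3) K) : MvPolynomial (Fin 3) K :=
  (pderiv 1 f) ^ 2 - 4 * pderiv 0 f * pderiv 2 f

section deg
variable (d : ℕ)
open MvPolynomial

lemma deg_mul {f g : MvPolynomial (Fin 3) K} {a b : ℕ} (hf : f.totalDegree ≤ a) (hg : g.totalDegree ≤ b) :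
    (f * g).totalDegree ≤ a + b := (totalDegree_mul f g).trans (by omega)
lemma deg_add {f g : MvPolynomial (Fin 3) K} {a : ℕ} (hf : f.totalDegree ≤ a) (hg : g.totalDegree ≤ a) :
    (f + g).totalDegree ≤ a := (totalDegree_add f g).trans (max_le hf hg)
lemma deg_sub {f g : MvPolynomial (Fin 3) K} {a : ℕ} (hf : f.totalDegree ≤ a) (hg : g.totalDegree ≤ a) :
    (f - g).totalDegree ≤ a := (totalDegree_sub f g).trans (max_le hf hg)
lemma deg_neg {f : MvPolynomial (Fin 3) K} {a : ℕ} (hf : f.totalDegree ≤ a) :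
    (-f).totalDegree ≤ a := by rwa [totalDegree_neg]
lemma deg_cmul {f : MvPolynomial (Fin 3) K} {a : ℕ} (c : K) (hf : f.totalDegree ≤ a) :
    (C c * f).totalDegree ≤ a := (deg_mul (totalDegree_C c).le hf).trans (by omega)
lemma deg_pow {f : MvPolynomial (Fin 3) K} {a : ℕ} (n : ℕ) (hf : f.totalDegree ≤ a) :
    (f ^ n).totalDegree ≤ n * a := (totalDegree_pow f n).trans (Nat.mul_le_mul_left _ hf)

lemma deg_RR (f : MvPolynomial (Fin 3) K) (d : ℕ) (hf : f.totalDegree ≤ d) :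
    (RR1 f).totalDegree ≤ 4 * d ∧ (RR0 f).totalDegree ≤ 4 * d ∧ (disc f).totalDegree ≤ 2 * d := by
  have h1 : ∀ i, (pderiv i f).totalDegree ≤ d := fun i => (totalDegree_pderiv_le i f).trans (by omega)
  have h2 : ∀ i j, (pderiv i (pderiv j f)).totalDegree ≤ d :=
    fun i j => (totalDegree_pderiv_le i _).trans (by have := h1 j; omega)
  have e2 : (-2 : MvPolynomial (Fin 3) K) = C (-2) := by rw [map_neg, map_ofNat]
  have e3 : (2 : MvPolynomial (Fin 3) K) = C 2 := (map_ofNat C 2).symm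
  have e4 : (4 : MvPolynomial (Fin 3) K) = C 4 := (map_ofNat C 4).symm
  have B0 : ((pderiv 0 f) ^ 2 * (pderiv 1 (pderiv 1 f) + 2 * pderiv 0 (pderiv 2 f))
    - pderiv 0 f * pderiv 2 f * pderiv 0 (pderiv 0 f)
    - (-pderiv 1 f) * (pderiv 0 f * (-2 * pderiv 0 (pderiv 1 f)) - (-pderiv 1 f) * pderiv 0 (pderiv 0 f))).totalDegree ≤ 3 * d := by
    rw [e2, e3]
    refine deg_sub (deg_sub ?_ ?_) ?_
    · exact (deg_mul (deg_pow 2 (h1 0)) (deg_add (h2 _ _) (deg_cmul _ (h2 _ _)))).trans (by omega)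
    · exact (deg_mul (deg_mul (h1 _) (h1 _)) (h2 _ _)).trans (by omega)
    · exact (deg_mul (deg_neg (h1 _)) (deg_sub (deg_mul (h1 _) (deg_cmul _ (h2 _ _))) (deg_mul (deg_neg (h1 _)) (h2 _ _)))).trans (by omega)
  refine ⟨?_, ?_, ?_⟩
  · unfold RR1
    refine deg_sub (deg_sub ?_ ?_) ((deg_mul (deg_neg (h1 1)) B0).trans (by omega))
    · rw [e2]; exact (deg_mul (deg_pow 3 (h1 0)) (deg_cmul _ (h2 _ _))).trans (by omega)
    · have : ((pderiv 0 f) ^ 2 * (-2 * pderiv 0 (pderiv 1 f)) - pderiv 0 f * (-pderiv 1 f) * pderiv 0 (pderiv 0 f)).totalDegree ≤ 3 * d := by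
        rw [e2]
        exact deg_sub ((deg_mul (deg_pow 2 (h1 0)) (deg_cmul _ (h2 _ _))).trans (by omega))
          ((deg_mul (deg_mul (h1 _) (deg_neg (h1 _))) (h2 _ _)).trans (by omega))
      exact (deg_mul (h1 2) this).trans (by omega)
  · unfold RR0
    refine deg_sub ?_ ((deg_mul (h1 2) B0).trans (by omega))
    exact (deg_mul (deg_pow 3 (h1 0)) (h2 _ _)).trans (by omega)
  · unfold disc
    rw [e4]
    exact deg_sub (deg_pow 2 (h1 1)) ((deg_mul (deg_cmul _ (h1 _)) (h1 _)).trans (by omega))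

end deg

end PartThreeC

section PartThreeD

variable {K : Type*} [Field K]

open MvPolynomial in
lemma ruled {p : ℕ} [CharP K p] (f : MvPolynomial (Fin 3) K) (hp : 4 * f.totalDegree < p)
    (q : K × K × K) (hq : rho q f = 0) (hF : rho q (pderiv 0 f) ≠ 0) (hD : rho q (disc f) ≠ 0)
    (h1 : f ∣ RR1 f) (h0 : f ∣ RR0 f) :
    ∃ c c' : K, rho q (pderiv 0 f) = (Polynomial.C c * Polynomial.X + Polynomial.C c') *
      (rho q (pderiv 1 f) - 2 * Polynomial.C q.1 * rho q (pderiv 0 f)) := by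
  obtain ⟨r1, hr1⟩ := h1
  obtain ⟨r0, hr0⟩ := h0
  set z := q.1 with hz
  set F := rho q (pderiv 0 f) with hFdef
  set V := rho q (pderiv 1 f) with hVdef
  set G := V - 2 * Polynomial.C z * F with hG
  have hQ1 : rho q (Dz z f) = 0 := Dz_vanish q f hq
  have hQ2 : rho q (Dz z (Dz z f)) = 0 := Dz_vanish q _ hQ1
  have hG2 : rho q (disc f) = G ^ 2 := by
    have : rho q (Dz z f) = Polynomial.C z ^ 2 * F - Polynomial.C z * V + rho q (pderiv 2 f) := by
      simp only [Dz, map_add, map_sub, map_mul, rho_C, map_pow, hFdef, hVdef]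
    rw [hQ1] at this
    simp only [disc, map_sub, map_mul, map_pow, map_ofNat, ← hFdef, ← hVdef, hG]
    linear_combination 4 * F * this
  have hG0 : G ≠ 0 := by
    rintro h; rw [hG2, h] at hD; simp at hD
  obtain ⟨β0, hβ0⟩ : ∃ β0, β0 = (pderiv 0 f) ^ 2 * (pderiv 1 (pderiv 1 f) + 2 * pderiv 0 (pderiv 2 f))
    - pderiv 0 f * pderiv 2 f * pderiv 0 (pderiv 0 f)
    - (-pderiv 1 f) * (pderiv 0 f * (-2 * pderiv 0 (pderiv 1 f)) - (-pderiv 1 f) * pderiv 0 (pderiv 0 f)) := ⟨_, rfl⟩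
  obtain ⟨β1, hβ1⟩ : ∃ β1, β1 = (pderiv 0 f) ^ 2 * (-2 * pderiv 0 (pderiv 1 f)) - pderiv 0 f * (-pderiv 1 f) * pderiv 0 (pderiv 0 f) := ⟨_, rfl⟩
  obtain ⟨β2, hβ2⟩ : ∃ β2, β2 = (pderiv 0 f) ^ 2 * pderiv 0 (pderiv 0 f) := ⟨_, rfl⟩
  obtain ⟨β, hβ⟩ : ∃ β, β = C z ^ 2 * β2 + C z * β1 + β0 := ⟨_, rfl⟩
  obtain ⟨α, hα⟩ : ∃ α, α = r1 * C z + r0 := ⟨_, rfl⟩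
  have id1 : (pderiv 0 f) ^ 3 * Dz z (Dz z f) = Dz z f * β + f * α := by
    rw [hα, hβ, hβ0, hβ1, hβ2, Dz_Dz]
    have e : f * (r1 * C z + r0) = RR1 f * C z + RR0 f := by rw [hr1, hr0]; ring
    rw [e]
    simp only [Dz, RR1, RR0, map_pow]
    ring
  have id2 : (pderiv 0 f) ^ 3 * (2 * Dz z (2 * C z * pderiv 0 f - pderiv 1 f)) =
      (2 * C z * pderiv 0 f - pderiv 1 f) * β + Dz z f * (2 * C z * β2 + β1) + f * r1 := by
    rw [hβ, ← hr1]
    have e : Dz z (2 * C z * pderiv 0 f - pderiv 1 f) = 2 * C z * (Dz z (pderiv 0 f)) - Dz z (pderiv 1 f) := by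
      have : (2 * C z : MvPolynomial (Fin 3) K) = C (2 * z) := by rw [map_mul, map_ofNat]
      rw [this]
      simp only [Dz, map_sub, pderiv_mul, pderiv_C]
      ring
    rw [e]
    simp only [Dz]
    rw [pderiv_comm' 1 0, pderiv_comm' 2 0, pderiv_comm' 2 1]
    rw [hβ0, hβ1, hβ2, RR1]
    simp only [map_pow]
    ring
  have key : ∀ i, F ^ 3 * Polynomial.derivative (Polynomial.derivative (rho q (pderiv i f))) =
      Polynomial.derivative (rho q (pderiv i f)) * rho q β + rho q (pderiv i f) * rho q α := by
    intro i
    have h := congrArg (fun P => rho q (pderiv i P)) id1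
    simp only [pderiv_mul, map_add, map_mul, hQ1, hQ2, hq, Dz_pderiv, map_pow] at h
    rw [rho_deriv, rho_deriv]
    linear_combination h
  have kG : F ^ 3 * Polynomial.derivative (Polynomial.derivative G) =
      Polynomial.derivative G * rho q β + G * rho q α := by
    have k0 := key 0
    have k1 := key 1
    have e : ∀ P : Polynomial K, Polynomial.derivative (2 * Polynomial.C z * P) = 2 * Polynomial.C z * Polynomial.derivative P := by
      intro P
      have : (2 * Polynomial.C z : Polynomial K) = Polynomial.C (2 * z) := by rw [map_mul, map_ofNat]
      rw [this, Polynomial.derivative_C_mul]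
    rw [hG, Polynomial.derivative_sub, Polynomial.derivative_sub, e, e]
    linear_combination k1 - 2 * Polynomial.C z * k0
  have kG2 : 2 * F ^ 3 * Polynomial.derivative G = G * rho q β := by
    have h := congrArg (rho q) id2
    have e : G = - rho q (2 * C z * pderiv 0 f - pderiv 1 f) := by
      simp only [map_sub, map_mul, rho_C, map_ofNat, hG, hFdef, hVdef]; ring
    rw [e, Polynomial.derivative_neg, rho_deriv]
    simp only [map_add, map_mul, map_pow, hQ1, hq, zero_mul, add_zero, map_ofNat] at h
    linear_combination -h
  obtain ⟨W, hW⟩ : ∃ W, W = Polynomial.derivative F * G - F * Polynomial.derivative G := ⟨_, rfl⟩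
  have hW' : F ^ 3 * Polynomial.derivative W = rho q β * W := by
    rw [hW]
    simp only [Polynomial.derivative_sub, Polynomial.derivative_mul]
    have k0 := key 0
    linear_combination G * k0 - F * kG
  have hW2 : G * Polynomial.derivative W = 2 * Polynomial.derivative G * W := by
    have : F ^ 3 * (G * Polynomial.derivative W - 2 * Polynomial.derivative G * W) = 0 := by
      linear_combination G * hW' - W * kG2
    have := (mul_eq_zero.1 this).resolve_left (pow_ne_zero _ hF)
    linear_combination this
  have dF : F.natDegree ≤ f.totalDegree := (rho_natDegree_le _ _).trans ((totalDegree_pderiv_le _ _).trans (by omega))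
  have dV : V.natDegree ≤ f.totalDegree := (rho_natDegree_le _ _).trans ((totalDegree_pderiv_le _ _).trans (by omega))
  have dG : G.natDegree ≤ f.totalDegree := by
    rw [hG]
    refine (Polynomial.natDegree_sub_le _ _).trans (max_le dV ?_)
    have : (2 * Polynomial.C z : Polynomial K) = Polynomial.C (2 * z) := by rw [map_mul, map_ofNat]
    rw [this]
    exact (Polynomial.natDegree_C_mul_le _ _).trans dF
  have dW : W.natDegree ≤ 2 * f.totalDegree := by
    rw [hW]
    have a1 := Polynomial.natDegree_derivative_le F
    have a2 := Polynomial.natDegree_derivative_le G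
    refine (Polynomial.natDegree_sub_le _ _).trans (max_le ?_ ?_)
    · refine Polynomial.natDegree_mul_le.trans ?_; omega
    · refine Polynomial.natDegree_mul_le.trans ?_; omega
  obtain ⟨c, hc⟩ := wronski (p := p) W (G ^ 2) (pow_ne_zero _ hG0) (by omega)
    (by have := Polynomial.natDegree_pow_le (p := G) (n := 2); omega)
    (by rw [pow_two, Polynomial.derivative_mul]; linear_combination G * hW2)
  have d1 : f.totalDegree ≠ 0 := by
    intro h
    rw [totalDegree_eq_zero_iff_eq_C] at h
    apply hF
    rw [hFdef, h, pderiv_C, map_zero]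
  obtain ⟨c', hc'⟩ := wronski (p := p) (F - Polynomial.C c * Polynomial.X * G) G hG0 (by
      refine lt_of_le_of_lt (Polynomial.natDegree_sub_le _ _) (max_lt (by omega) ?_)
      refine lt_of_le_of_lt Polynomial.natDegree_mul_le ?_
      have : (Polynomial.C c * Polynomial.X).natDegree ≤ 1 := by compute_degree
      omega) (by omega) (by
      simp only [Polynomial.derivative_sub, Polynomial.derivative_mul, Polynomial.derivative_C, Polynomial.derivative_X]
      linear_combination hc - hW)
  refine ⟨c, c', ?_⟩
  linear_combination hc'

open MvPolynomial in
lemma component {p : ℕ} [CharP K p] (f : MvPolynomial (Fin 3) K)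
    (hf : Irreducible f) (hp : 4 * f.totalDegree < p) :
    ∃ H : MvPolynomial (Fin 3) K, ¬ f ∣ H ∧ H.totalDegree ≤ 4 * f.totalDegree ∧
      ∀ q0 : K × K × K, rho q0 f = 0 → rho q0 H ≠ 0 → ∃ c c' : K, ∀ q1, rho q1 f = 0 → meet q0 q1 →
        (rho q0 H).eval (mw q0 q1) = 0 ∨ (c * mw q0 q1 + c') * (q1.1 - q0.1) = 1 := by
  have hd1 := irred_deg f hf
  have hdeg : ∀ i, (pderiv i f).totalDegree < f.totalDegree := fun i =>
    lt_of_le_of_lt (totalDegree_pderiv_le i f) (by omega)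
  obtain ⟨dR1, dR0, dD⟩ := deg_RR f _ le_rfl
  by_cases hu : pderiv 0 f = 0
  · -- fu = 0
    have cross : ∀ q0 q1, rho q0 f = 0 → rho q1 f = 0 → meet q0 q1 →
        (rho q0 (pderiv 1 f)).eval (mw q0 q1) = 0 ∧ (rho q0 (pderiv 2 f)).eval (mw q0 q1) = 0 := by
      intro q0 q1 h0 h1 hm
      have a0 := root_one f q0 h0 (mw q0 q1)
      have a1 := root_one f q1 h1 (mw q0 q1)
      simp only [← meet_eval hm] at a1
      simp only [hu, map_zero, Polynomial.eval_zero] at a0 a1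
      have hV : (rho q0 (pderiv 1 f)).eval (mw q0 q1) = 0 := by
        apply (mul_eq_zero.1 (show (q1.1 - q0.1) * _ = 0 by linear_combination a0 - a1)).resolve_left
        exact sub_ne_zero.2 hm.1.symm
      refine ⟨hV, ?_⟩
      rw [hV] at a0
      linear_combination a0
    obtain ⟨i, hi⟩ := exists_pderiv_ne (p := p) f hd1 (by omega)
    refine ⟨pderiv i f, not_dvd_of_deg _ _ hi (hdeg i), (hdeg i).le.trans (by omega), ?_⟩
    intro q0 h0 _
    refine ⟨0, 0, fun q1 h1 hm => Or.inl ?_⟩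
    have := cross q0 q1 h0 h1 hm
    fin_cases i
    · exact absurd hu hi
    · exact this.1
    · exact this.2
  by_cases hD : f ∣ disc f
  · refine ⟨pderiv 0 f, not_dvd_of_deg _ _ hu (hdeg 0), (hdeg 0).le.trans (by omega), ?_⟩
    intro q0 h0 _
    refine ⟨0, 0, fun q1 h1 hm => Or.inl ?_⟩
    have a0 := root_one f q0 h0 (mw q0 q1)
    have a1 := root_one f q1 h1 (mw q0 q1)
    simp only [← meet_eval hm] at a1
    obtain ⟨r, hr⟩ := hD
    have h2 := congrArg (fun P => (rho q0 P).eval (mw q0 q1)) hr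
    simp only [map_mul, h0, zero_mul, Polynomial.eval_zero, disc, map_sub, map_pow, map_ofNat,
      Polynomial.eval_sub, Polynomial.eval_mul, Polynomial.eval_pow, Polynomial.eval_ofNat] at h2
    set a := (rho q0 (pderiv 0 f)).eval (mw q0 q1)
    set b := (rho q0 (pderiv 1 f)).eval (mw q0 q1)
    have hb : b = a * (q0.1 + q1.1) := by
      have : (q0.1 - q1.1) * (b - a * (q0.1 + q1.1)) = 0 := by linear_combination a1 - a0
      exact sub_eq_zero.1 ((mul_eq_zero.1 this).resolve_left (sub_ne_zero.2 hm.1))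
    have : (a * (q0.1 - q1.1)) ^ 2 = 0 := by
      rw [hb] at h2 a0
      linear_combination h2 + 4 * a * a0
    exact (mul_eq_zero.1 (pow_eq_zero_iff (two_ne_zero) |>.1 this)).resolve_right (sub_ne_zero.2 hm.1)
  by_cases hR1 : f ∣ RR1 f
  swap
  · exact ⟨RR1 f, hR1, dR1, fun q0 h0 _ => ⟨0, 0, fun q1 h1 hm => Or.inl (RR_cross f q0 q1 h0 h1 hm).1⟩⟩
  by_cases hR0 : f ∣ RR0 f
  swap
  · exact ⟨RR0 f, hR0, dR0, fun q0 h0 _ => ⟨0, 0, fun q1 h1 hm => Or.inl (RR_cross f q0 q1 h0 h1 hm).2⟩⟩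
  refine ⟨pderiv 0 f * disc f, ?_, (deg_mul (hdeg 0).le dD).trans (by omega), ?_⟩
  · intro h
    rcases hf.prime.dvd_or_dvd h with h | h
    · exact not_dvd_of_deg _ _ hu (hdeg 0) h
    · exact hD h
  · intro q0 h0 hne
    rw [map_mul] at hne
    obtain ⟨c, c', hc⟩ := ruled (p := p) f hp q0 h0 (left_ne_zero_of_mul hne) (right_ne_zero_of_mul hne) hR1 hR0
    refine ⟨c, c', fun q1 h1 hm => ?_⟩
    have a0 := root_one f q0 h0 (mw q0 q1)
    have a1 := root_one f q1 h1 (mw q0 q1)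
    simp only [← meet_eval hm] at a1
    have h2 := congrArg (fun P => P.eval (mw q0 q1)) hc
    simp only [Polynomial.eval_sub, Polynomial.eval_mul, Polynomial.eval_add, Polynomial.eval_C,
      Polynomial.eval_X, Polynomial.eval_ofNat] at h2
    rw [map_mul, Polynomial.eval_mul]
    set a := (rho q0 (pderiv 0 f)).eval (mw q0 q1)
    set b := (rho q0 (pderiv 1 f)).eval (mw q0 q1)
    have hb : b = a * (q0.1 + q1.1) := by
      have : (q0.1 - q1.1) * (b - a * (q0.1 + q1.1)) = 0 := by linear_combination a1 - a0
      exact sub_eq_zero.1 ((mul_eq_zero.1 this).resolve_left (sub_ne_zero.2 hm.1))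
    by_cases ha : a = 0
    · left; rw [ha, zero_mul]
    · right
      rw [hb] at h2
      have : a * ((c * mw q0 q1 + c') * (q1.1 - q0.1) - 1) = 0 := by linear_combination -h2
      exact sub_eq_zero.1 ((mul_eq_zero.1 this).resolve_left ha)

end PartThreeD

section PartFour

variable {K : Type*} [Field K]

def Skew (P : Finset (K × K × K)) : Prop :=
  ∀ q ∈ P, ∀ q' ∈ P, q.2.2 - q'.2.2 = q.1 * q'.2.1 - q'.1 * q.2.1 → q = q'

lemma Skew.mono {P P' : Finset (K × K × K)} (h : Skew P) (hs : P' ⊆ P) : Skew P' :=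
  fun q hq q' hq' => h q (hs hq) q' (hs hq')

lemma mw_inj {P : Finset (K × K × K)} (hP : Skew P) (q : K × K × K) {q1 q2 : K × K × K}
    (h1 : q1 ∈ P) (h2 : q2 ∈ P) (m1 : meet q q1) (m2 : meet q q2) (hw : mw q q1 = mw q q2) : q1 = q2 := by
  apply hP q1 h1 q2 h2
  have a1 := mw_mul m1
  have a2 := mw_mul m2
  rw [← hw] at a2
  have b1 := m1.2
  have b2 := m2.2
  set w := mw q q1
  have e1 : q1.2.1 = q.2.1 - w * (q.1 - q1.1) := by linear_combination a1
  have e2 : q2.2.1 = q.2.1 - w * (q.1 - q2.1) := by linear_combination a2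
  rw [e1] at b1 ⊢
  rw [e2] at b2 ⊢
  linear_combination b2 - b1

open Classical in
noncomputable def inc (P1 P2 : Finset (K × K × K)) : ℕ := ∑ q ∈ P1, (P2.filter (meet q)).card

lemma inc_symm (P1 P2 : Finset (K × K × K)) : inc P1 P2 = inc P2 P1 := by
  classical
  unfold inc
  have := Finset.sum_card_bipartiteAbove_eq_sum_card_bipartiteBelow (s := P1) (t := P2) meet
  simp only [Finset.bipartiteAbove, Finset.bipartiteBelow] at this
  rw [this]
  refine Finset.sum_congr rfl fun q _ => ?_
  congr 1
  apply Finset.filter_congr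
  intro x _
  exact ⟨meet_symm, meet_symm⟩

lemma inc_split_left (P1 P2 : Finset (K × K × K)) (c : K × K × K → Prop) [DecidablePred c] :
    inc P1 P2 = inc (P1.filter c) P2 + inc (P1.filter fun q => ¬ c q) P2 := by
  unfold inc
  rw [Finset.sum_filter_add_sum_filter_not]

lemma inc_split_right (P1 P2 : Finset (K × K × K)) (c : K × K × K → Prop) [DecidablePred c] :
    inc P1 P2 = inc P1 (P2.filter c) + inc P1 (P2.filter fun q => ¬ c q) := by
  rw [inc_symm, inc_split_left _ _ c, inc_symm P1, inc_symm P1]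

lemma inc_mono {P1 P2 P1' P2' : Finset (K × K × K)} (h1 : P1 ⊆ P1') (h2 : P2 ⊆ P2') :
    inc P1 P2 ≤ inc P1' P2' := by
  classical
  unfold inc
  refine (Finset.sum_le_sum_of_subset h1).trans (Finset.sum_le_sum fun q _ => ?_)
  exact Finset.card_le_card (Finset.filter_subset_filter _ h2)

lemma inc_union_left [DecidableEq K] (P1 P1' P2 : Finset (K × K × K)) (h : Disjoint P1 P1') :
    inc (P1 ∪ P1') P2 = inc P1 P2 + inc P1' P2 := by
  unfold inc
  rw [Finset.sum_union h]

lemma inc_le_mul (P1 P2 : Finset (K × K × K)) : inc P1 P2 ≤ P1.card * P2.card := by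
  classical
  unfold inc
  refine (Finset.sum_le_card_nsmul _ _ P2.card fun q _ => Finset.card_filter_le _ _).trans ?_
  simp

lemma count_zero {P : Finset (K × K × K)} (hP : Skew P) (q : K × K × K) (H : MvPolynomial (Fin 3) K)
    (hq : rho q H ≠ 0) (S : Finset (K × K × K)) (hS : S ⊆ P)
    (h : ∀ q' ∈ S, meet q q' ∧ (rho q H).eval (mw q q') = 0) : S.card ≤ H.totalDegree := by
  classical
  calc S.card ≤ (rho q H).roots.toFinset.card := by
        apply Finset.card_le_card_of_injOn (mw q)
        · intro q' hq'
          simp only [Finset.mem_coe, Multiset.mem_toFinset]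
          rw [Polynomial.mem_roots hq]
          exact (h q' hq').2
        · intro a ha b hb hab
          exact mw_inj hP q (hS ha) (hS hb) (h a ha).1 (h b hb).1 hab
    _ ≤ Multiset.card (rho q H).roots := Multiset.toFinset_card_le _
    _ ≤ (rho q H).natDegree := Polynomial.card_roots' _
    _ ≤ H.totalDegree := rho_natDegree_le _ _

/-- lines outside a surface meet lines inside it rarely -/
lemma inc_out {P1 P2 : Finset (K × K × K)} (hP : Skew P2) (H : MvPolynomial (Fin 3) K)
    (h1 : ∀ q ∈ P1, rho q H ≠ 0) (h2 : ∀ q ∈ P2, rho q H = 0) :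
    inc P1 P2 ≤ H.totalDegree * P1.card := by
  classical
  unfold inc
  refine (Finset.sum_le_card_nsmul _ _ H.totalDegree fun q hq => ?_).trans (by rw [smul_eq_mul, mul_comm])
  apply count_zero hP q H (h1 q hq) _ (Finset.filter_subset _ _)
  intro q' hq'
  rw [Finset.mem_filter] at hq'
  refine ⟨hq'.2, ?_⟩
  rw [meet_eval hq'.2, h2 q' hq'.1]; simp

lemma count_reg [DecidableEq K] {P : Finset (K × K × K)} (hP : Skew P) (q : K × K × K) (c c' : K) (k : ℕ)
    (hk1 : (P.image fun q => q.1).card ≤ k) (hk2 : (P.image fun q => q.2.1).card ≤ k)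
    (S : Finset (K × K × K)) (hS : S ⊆ P)
    (h : ∀ q' ∈ S, meet q q' ∧ (c * mw q q' + c') * (q'.1 - q.1) = 1) : S.card ≤ k := by
  by_cases hc : c = 0
  · refine le_trans ?_ hk2
    refine Finset.card_le_card_of_injOn (fun q => q.2.1) ?_ ?_
    · intro a ha
      exact Finset.mem_coe.2 (Finset.mem_image_of_mem _ (hS ha))
    · intro a ha b hb hab
      simp only at hab
      apply mw_inj hP q (hS ha) (hS hb) (h a ha).1 (h b hb).1
      have e1 := (h a ha).2
      have e2 := (h b hb).2
      rw [hc, zero_mul, zero_add] at e1 e2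
      have hc' : c' ≠ 0 := by rintro rfl; simp at e1
      have : c' * (a.1 - b.1) = 0 := by linear_combination e1 - e2
      have : a.1 = b.1 := sub_eq_zero.1 ((mul_eq_zero.1 this).resolve_left hc')
      unfold mw
      rw [hab, this]
  · refine le_trans ?_ hk1
    refine Finset.card_le_card_of_injOn (fun q => q.1) ?_ ?_
    · intro a ha
      exact Finset.mem_coe.2 (Finset.mem_image_of_mem _ (hS ha))
    · intro a ha b hb hab
      simp only at hab
      apply mw_inj hP q (hS ha) (hS hb) (h a ha).1 (h b hb).1
      have e1 := (h a ha).2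
      have e2 := (h b hb).2
      rw [hab] at e1
      have hne : b.1 - q.1 ≠ 0 := by intro h0; rw [h0] at e1; simp at e1
      have : (c * (mw q a - mw q b)) * (b.1 - q.1) = 0 := by linear_combination e1 - e2
      have := (mul_eq_zero.1 this).resolve_right hne
      exact sub_eq_zero.1 ((mul_eq_zero.1 this).resolve_left hc)

lemma comp_count [DecidableEq K] {p : ℕ} [CharP K p] (f : MvPolynomial (Fin 3) K)
    (hf : Irreducible f) (hp : 4 * f.totalDegree < p) (P1 P2 : Finset (K × K × K))
    (s1 : Skew P1) (s2 : Skew P2) (h1 : ∀ q ∈ P1, rho q f = 0) (h2 : ∀ q ∈ P2, rho q f = 0) (k : ℕ)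
    (hk1 : (P2.image fun q => q.1).card ≤ k) (hk2 : (P2.image fun q => q.2.1).card ≤ k) :
    ∃ E1 ⊆ P1, ∃ E2 ⊆ P2, E1.card ≤ 4 * f.totalDegree ^ 2 ∧ E2.card ≤ 4 * f.totalDegree ^ 2 ∧
      inc P1 P2 ≤ inc E1 E2 + (4 * f.totalDegree + k) * P1.card + 4 * f.totalDegree * P2.card := by
  classical
  obtain ⟨H, hfH, hdH, hcomp⟩ := component (p := p) f hf hp
  have hcard : ∀ P : Finset (K × K × K), (∀ q ∈ P, rho q f = 0) →
      (P.filter fun q => rho q H = 0).card ≤ 4 * f.totalDegree ^ 2 := by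
    intro P hP
    have := bezout_lines f H hf hfH (P.filter fun q => rho q H = 0)
      (fun q hq => hP q (Finset.mem_filter.1 hq).1) (fun q hq => (Finset.mem_filter.1 hq).2)
    refine this.trans ?_
    calc f.totalDegree * H.totalDegree ≤ f.totalDegree * (4 * f.totalDegree) := Nat.mul_le_mul_left _ hdH
      _ = _ := by ring
  refine ⟨P1.filter fun q => rho q H = 0, Finset.filter_subset _ _,
    P2.filter fun q => rho q H = 0, Finset.filter_subset _ _, hcard P1 h1, hcard P2 h2, ?_⟩
  rw [inc_split_left P1 P2 (fun q => rho q H = 0), inc_split_right (P1.filter _) P2 (fun q => rho q H = 0)]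
  have b1 : inc (P1.filter fun q => ¬ rho q H = 0) P2 ≤ (4 * f.totalDegree + k) * P1.card := by
    have : inc (P1.filter fun q => ¬ rho q H = 0) P2 ≤
        (P1.filter fun q => ¬ rho q H = 0).card • (4 * f.totalDegree + k) := by
      apply Finset.sum_le_card_nsmul
      intro q hq
      rw [Finset.mem_filter] at hq
      obtain ⟨c, c', hcc⟩ := hcomp q (h1 q hq.1) hq.2
      rw [← Finset.card_filter_add_card_filter_not (s := P2.filter (meet q)) (fun q' => (rho q H).eval (mw q q') = 0)]
      apply Nat.add_le_add
      · refine (count_zero s2 q H hq.2 _ ((Finset.filter_subset _ _).trans (Finset.filter_subset _ _)) ?_).trans hdH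
        intro q' hq'
        rw [Finset.mem_filter, Finset.mem_filter] at hq'
        exact ⟨hq'.1.2, hq'.2⟩
      · apply count_reg s2 q c c' k hk1 hk2 _ ((Finset.filter_subset _ _).trans (Finset.filter_subset _ _))
        intro q' hq'
        rw [Finset.mem_filter, Finset.mem_filter] at hq'
        exact ⟨hq'.1.2, (hcc q' (h2 q' hq'.1.1) hq'.1.2).resolve_left hq'.2⟩
    refine this.trans ?_
    rw [smul_eq_mul, mul_comm]
    exact Nat.mul_le_mul_left _ (Finset.card_filter_le _ _)
  have b2 : inc (P1.filter fun q => rho q H = 0) (P2.filter fun q => ¬ rho q H = 0) ≤ 4 * f.totalDegree * P2.card := by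
    rw [inc_symm]
    refine (inc_out (s1.mono (Finset.filter_subset _ _)) H (fun q hq => (Finset.mem_filter.1 hq).2)
      (fun q hq => (Finset.mem_filter.1 hq).2)).trans ?_
    exact Nat.mul_le_mul hdH (Finset.card_filter_le _ _)
  omega

lemma poly_count [DecidableEq K] {p : ℕ} [CharP K p] (f : MvPolynomial (Fin 3) K) (hf0 : f ≠ 0)
    (hp : 4 * f.totalDegree < p) (P1 P2 : Finset (K × K × K))
    (s1 : Skew P1) (s2 : Skew P2) (h1 : ∀ q ∈ P1, rho q f = 0) (h2 : ∀ q ∈ P2, rho q f = 0) (k : ℕ)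
    (hk1 : (P2.image fun q => q.1).card ≤ k) (hk2 : (P2.image fun q => q.2.1).card ≤ k) :
    ∃ E1 ⊆ P1, ∃ E2 ⊆ P2, E1.card ≤ 4 * f.totalDegree ^ 2 ∧ E2.card ≤ 4 * f.totalDegree ^ 2 ∧
      inc P1 P2 ≤ inc E1 E2 + (4 * f.totalDegree + k) * P1.card + 4 * f.totalDegree * P2.card := by
  classical
  induction f using WfDvdMonoid.induction_on_irreducible generalizing P1 P2 with
  | zero => exact absurd rfl hf0
  | unit u hu =>
    have : P1 = ∅ := by
      rw [Finset.eq_empty_iff_forall_notMem]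
      intro q hq
      have := (hu.map (rho q)).ne_zero
      exact this (h1 q hq)
    subst this
    exact ⟨∅, by simp, ∅, by simp, by simp, by simp, by simp [inc]⟩
  | mul h g hh0 hg ih =>
    have hg0 := hg.ne_zero
    rw [MvPolynomial.totalDegree_mul_of_isDomain hg0 hh0] at hp ⊢
    set a := g.totalDegree
    set b := h.totalDegree
    have hout : ∀ P : Finset (K × K × K), (∀ q ∈ P, rho q (g * h) = 0) →
        ∀ q ∈ P.filter (fun q => ¬ rho q g = 0), rho q h = 0 := by
      intro P hP q hq
      rw [Finset.mem_filter] at hq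
      have := hP q hq.1
      rw [map_mul] at this
      exact (mul_eq_zero.1 this).resolve_left hq.2
    obtain ⟨A1, hA1, A2, hA2, cA1, cA2, iA⟩ := comp_count (p := p) g hg (by omega)
      (P1.filter fun q => rho q g = 0) (P2.filter fun q => rho q g = 0)
      (s1.mono (Finset.filter_subset _ _)) (s2.mono (Finset.filter_subset _ _))
      (fun q hq => (Finset.mem_filter.1 hq).2) (fun q hq => (Finset.mem_filter.1 hq).2) k
      ((Finset.card_le_card (Finset.image_subset_image (Finset.filter_subset _ _))).trans hk1)
      ((Finset.card_le_card (Finset.image_subset_image (Finset.filter_subset _ _))).trans hk2)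
    obtain ⟨B1, hB1, B2, hB2, cB1, cB2, iB⟩ := ih hh0 (by omega)
      (P1.filter fun q => ¬ rho q g = 0) (P2.filter fun q => ¬ rho q g = 0)
      (s1.mono (Finset.filter_subset _ _)) (s2.mono (Finset.filter_subset _ _))
      (hout P1 h1) (hout P2 h2)
      ((Finset.card_le_card (Finset.image_subset_image (Finset.filter_subset _ _))).trans hk1)
      ((Finset.card_le_card (Finset.image_subset_image (Finset.filter_subset _ _))).trans hk2)
    have d1 : Disjoint A1 B1 := Finset.disjoint_of_subset_left hA1 (Finset.disjoint_of_subset_right hB1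
      (Finset.disjoint_filter_filter_not _ _ _))
    refine ⟨A1 ∪ B1, Finset.union_subset (hA1.trans (Finset.filter_subset _ _)) (hB1.trans (Finset.filter_subset _ _)),
      A2 ∪ B2, Finset.union_subset (hA2.trans (Finset.filter_subset _ _)) (hB2.trans (Finset.filter_subset _ _)), ?_, ?_, ?_⟩
    · refine (Finset.card_union_le _ _).trans ?_
      nlinarith [Nat.zero_le (a * b)]
    · refine (Finset.card_union_le _ _).trans ?_
      nlinarith [Nat.zero_le (a * b)]
    · rw [inc_union_left _ _ _ d1]
      have m1 : inc A1 A2 ≤ inc A1 (A2 ∪ B2) := inc_mono subset_rfl Finset.subset_union_left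
      have m2 : inc B1 B2 ≤ inc B1 (A2 ∪ B2) := inc_mono subset_rfl Finset.subset_union_right
      rw [inc_split_left P1 P2 (fun q => rho q g = 0), inc_split_right (P1.filter fun q => rho q g = 0) P2 (fun q => rho q g = 0),
        inc_split_right (P1.filter fun q => ¬ rho q g = 0) P2 (fun q => rho q g = 0)]
      have c1 : inc (P1.filter fun q => rho q g = 0) (P2.filter fun q => ¬ rho q g = 0) ≤
          a * (P2.filter fun q => ¬ rho q g = 0).card := by
        rw [inc_symm]
        exact inc_out (s1.mono (Finset.filter_subset _ _)) g (fun q hq => (Finset.mem_filter.1 hq).2)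
          (fun q hq => (Finset.mem_filter.1 hq).2)
      have c2 : inc (P1.filter fun q => ¬ rho q g = 0) (P2.filter fun q => rho q g = 0) ≤
          a * (P1.filter fun q => ¬ rho q g = 0).card :=
        inc_out (s2.mono (Finset.filter_subset _ _)) g (fun q hq => (Finset.mem_filter.1 hq).2)
          (fun q hq => (Finset.mem_filter.1 hq).2)
      have e1 := Finset.card_filter_add_card_filter_not (s := P1) (fun q => rho q g = 0)
      have e2 := Finset.card_filter_add_card_filter_not (s := P2) (fun q => rho q g = 0)
      rw [← e1, ← e2]
      set x := (P1.filter fun q => rho q g = 0).card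
      set x' := (P1.filter fun q => ¬ rho q g = 0).card
      set y := (P2.filter fun q => rho q g = 0).card
      set y' := (P2.filter fun q => ¬ rho q g = 0).card
      have n1 := Nat.zero_le (b * x)
      have n2 := Nat.zero_le (b * y)
      have n3 := Nat.zero_le (a * x')
      have n4 := Nat.zero_le (a * y')
      nlinarith

end PartFour

section PartFourB

variable {K : Type*} [Field K]

lemma chunk_arith (D s M : ℕ) (hD : 1 ≤ D) (h1 : 864 * D ≤ s) (h2 : s ≤ 2 * 864 * D)
    (hM : M * D ^ 2 ≤ 2 * s ^ 2) :
    M * (216 * 186624 * D ^ 3 + 27 * D * s ^ 2) ≤ 186624 * s ^ 3 := by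
  have e : M * (216 * 186624 * D ^ 3 + 27 * D * s ^ 2) * D = (M * D ^ 2) * (216 * 186624 * D ^ 2 + 27 * s ^ 2) := by ring
  have h3 : (M * D ^ 2) * (216 * 186624 * D ^ 2 + 27 * s ^ 2) ≤ 2 * s ^ 2 * (216 * 186624 * D ^ 2 + 27 * s ^ 2) :=
    Nat.mul_le_mul_right _ hM
  have h4 : 216 * 186624 * D ^ 2 ≤ 46656 * D * s := by nlinarith
  have h5 : 27 * s ^ 2 ≤ 46656 * D * s := by nlinarith
  have h6 : 2 * s ^ 2 * (216 * 186624 * D ^ 2 + 27 * s ^ 2) ≤ 2 * s ^ 2 * (46656 * D * s + 46656 * D * s) :=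
    Nat.mul_le_mul_left _ (Nat.add_le_add h4 h5)
  have h7 : 2 * s ^ 2 * (46656 * D * s + 46656 * D * s) = 186624 * s ^ 3 * D := by ring
  apply Nat.le_of_mul_le_mul_right _ hD
  omega

theorem main_inc [DecidableEq K] {p : ℕ} [CharP K p] (s : ℕ) (hs : s ≤ p) (k : ℕ)
    (P1 P2 : Finset (K × K × K)) (s1 : Skew P1) (s2 : Skew P2)
    (c1 : P1.card ≤ s ^ 2) (c2 : P2.card ≤ s ^ 2)
    (hk1 : (P2.image fun q => q.1).card ≤ k) (hk2 : (P2.image fun q => q.2.1).card ≤ k) :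
    inc P1 P2 ≤ 186624 * s ^ 3 + k * P1.card * (1 + Nat.log 2 s) := by
  classical
  induction s using Nat.strong_induction_on generalizing P1 P2 with
  | _ s IH =>
  rcases lt_or_ge s 864 with hlt | hge
  · refine (inc_le_mul P1 P2).trans ?_
    have : P1.card * P2.card ≤ s ^ 2 * s ^ 2 := Nat.mul_le_mul c1 c2
    have h3 : s ^ 2 * s ^ 2 = s ^ 3 * s := by ring
    have h4 : s ^ 3 * s ≤ s ^ 3 * 186624 := Nat.mul_le_mul_left _ (by omega)
    have h5 := Nat.zero_le (k * P1.card * (1 + Nat.log 2 s))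
    omega
  obtain ⟨D, hD⟩ : ∃ D, D = s / 864 := ⟨_, rfl⟩
  have hD1 : 1 ≤ D := by omega
  have hDs : 864 * D ≤ s := by omega
  have hDs2 : s ≤ 2 * 864 * D := by omega
  have hlog : 1 + Nat.log 2 (6 * D) ≤ Nat.log 2 s := by
    have h1 : Nat.log 2 (6 * D * 2) = Nat.log 2 (6 * D) + 1 := Nat.log_mul_base (by norm_num) (by omega)
    have h2 : Nat.log 2 (6 * D * 2) ≤ Nat.log 2 s := Nat.log_mono_right (by omega)
    omega
  -- one chunk
  have chunk : ∀ Q : Finset (K × K × K), Skew Q → Q.card ≤ D ^ 2 →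
      inc Q P2 ≤ (216 * 186624 * D ^ 3 + 27 * D * s ^ 2) + k * Q.card * (1 + Nat.log 2 s) := by
    intro Q sQ cQ
    obtain ⟨f, hf0, hfd, hfv⟩ := exists_vanishing Q (3 * D) (by
      have h3 := choose3 (3 * D)
      have h4 : Q.card * (3 * D + 1) ≤ D ^ 2 * (3 * D + 1) := Nat.mul_le_mul_right _ cQ
      nlinarith)
    have hΔ : f.totalDegree ≤ 3 * D := hfd
    obtain ⟨E1, hE1, E2, hE2, cE1, cE2, iE⟩ := poly_count (p := p) f hf0 (by omega) Q
      (P2.filter fun q => rho q f = 0) sQ (s2.mono (Finset.filter_subset _ _)) hfv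
      (fun q hq => (Finset.mem_filter.1 hq).2) k
      ((Finset.card_le_card (Finset.image_subset_image (Finset.filter_subset _ _))).trans hk1)
      ((Finset.card_le_card (Finset.image_subset_image (Finset.filter_subset _ _))).trans hk2)
    rw [inc_split_right Q P2 (fun q => rho q f = 0)]
    have o1 : inc Q (P2.filter fun q => ¬ rho q f = 0) ≤ 3 * D * s ^ 2 := by
      rw [inc_symm]
      refine (inc_out sQ f (fun q hq => (Finset.mem_filter.1 hq).2) hfv).trans ?_
      exact Nat.mul_le_mul hΔ ((Finset.card_filter_le _ _).trans c2)
    have hsq : 4 * f.totalDegree ^ 2 ≤ (6 * D) ^ 2 := by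
      have := Nat.pow_le_pow_left hΔ 2
      nlinarith
    have hEP : E2 ⊆ P2 := hE2.trans (Finset.filter_subset _ _)
    have i1 := IH (6 * D) (by omega) (by omega) E1 E2 (sQ.mono hE1) (s2.mono hEP) (cE1.trans hsq) (cE2.trans hsq)
      ((Finset.card_le_card (Finset.image_subset_image hEP)).trans hk1)
      ((Finset.card_le_card (Finset.image_subset_image hEP)).trans hk2)
    have i2 : k * E1.card * (1 + Nat.log 2 (6 * D)) ≤ k * Q.card * Nat.log 2 s :=
      Nat.mul_le_mul (Nat.mul_le_mul_left _ (Finset.card_le_card hE1)) hlog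
    have i3 : (4 * f.totalDegree + k) * Q.card ≤ 12 * D ^ 3 + k * Q.card := by
      rw [add_mul]
      have : 4 * f.totalDegree * Q.card ≤ 12 * D * D ^ 2 := Nat.mul_le_mul (by omega) cQ
      have e : 12 * D * D ^ 2 = 12 * D ^ 3 := by ring
      omega
    have i4 : 4 * f.totalDegree * (P2.filter fun q => rho q f = 0).card ≤ 12 * D * s ^ 2 :=
      Nat.mul_le_mul (by omega) ((Finset.card_filter_le _ _).trans c2)
    have i5 : 12 * D ^ 3 ≤ 12 * D * s ^ 2 := by
      have : D ^ 2 ≤ s ^ 2 := Nat.pow_le_pow_left (by omega) 2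
      calc 12 * D ^ 3 = 12 * D * D ^ 2 := by ring
        _ ≤ _ := Nat.mul_le_mul_left _ this
    have e1 : 186624 * (6 * D) ^ 3 = 216 * 186624 * D ^ 3 := by ring
    have e2 : k * Q.card * (1 + Nat.log 2 s) = k * Q.card + k * Q.card * Nat.log 2 s := by ring
    rw [e1] at i1
    rw [e2]
    have e3 : 27 * D * s ^ 2 = 27 * (D * s ^ 2) := by ring
    have e4 : 12 * D * s ^ 2 = 12 * (D * s ^ 2) := by ring
    have e5 : 3 * D * s ^ 2 = 3 * (D * s ^ 2) := by ring
    rw [e3]; rw [e4] at i4 i5; rw [e5] at o1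
    omega
  have all : ∀ M : ℕ, ∀ P : Finset (K × K × K), Skew P → P.card ≤ M * D ^ 2 →
      inc P P2 ≤ M * (216 * 186624 * D ^ 3 + 27 * D * s ^ 2) + k * P.card * (1 + Nat.log 2 s) := by
    intro M
    induction M with
    | zero =>
      intro P _ hP
      have : P = ∅ := by rw [← Finset.card_eq_zero]; omega
      subst this; simp [inc]
    | succ M ihM =>
      intro P sP hP
      obtain ⟨Q, hQP, hQ⟩ := Finset.exists_subset_card_eq (s := P) (n := min (D ^ 2) P.card) (min_le_right _ _)
      have h1 := chunk Q (sP.mono hQP) (by rw [hQ]; exact min_le_left _ _)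
      have hc := Finset.card_sdiff_add_card_eq_card hQP
      have h2 := ihM (P \ Q) (sP.mono Finset.sdiff_subset) (by
        rw [add_mul, one_mul] at hP
        rcases min_cases (D ^ 2) P.card with h | h <;> omega)
      have e : inc P P2 = inc (P \ Q) P2 + inc Q P2 := by
        rw [← inc_union_left _ _ _ Finset.sdiff_disjoint, Finset.sdiff_union_of_subset hQP]
      rw [e, ← hc]
      calc _ ≤ _ := Nat.add_le_add h2 h1
        _ = _ := by ring
  obtain ⟨M, hM⟩ : ∃ M, M = s ^ 2 / D ^ 2 + 1 := ⟨_, rfl⟩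
  have hD2 : 0 < D ^ 2 := by positivity
  have hM1 : s ^ 2 ≤ M * D ^ 2 := by
    rw [hM]
    have := Nat.lt_div_mul_add (a := s ^ 2) hD2
    rw [add_mul, one_mul]; omega
  have hM2 : M * D ^ 2 ≤ 2 * s ^ 2 := by
    rw [hM, add_mul, one_mul]
    have := Nat.div_mul_le_self (s ^ 2) (D ^ 2)
    have h3 : D ^ 2 ≤ s ^ 2 := Nat.pow_le_pow_left (by omega) 2
    omega
  have := all M P1 s1 (c1.trans hM1)
  have h2 := chunk_arith D s M hD1 hDs hDs2 hM2
  omega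

end PartFourB

section PartFive

lemma inc_eq_card {K : Type*} [Field K] (P1 P2 : Finset (K × K × K)) [DecidablePred fun x : (K × K × K) × (K × K × K) => meet x.1 x.2] :
    inc P1 P2 = ((P1 ×ˢ P2).filter (fun x => meet x.1 x.2)).card := by
  classical
  unfold inc
  rw [Finset.card_filter, Finset.sum_product]
  refine Finset.sum_congr rfl fun q _ => ?_
  rw [Finset.card_filter]
  refine Finset.sum_congr rfl fun y _ => ?_
  by_cases h : meet q y
  · rw [if_pos h, if_pos h]
  · rw [if_neg h, if_neg h]

variable {F : Type*} [Field F]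

lemma ratfunc_indep (a0 a1 a2 a3 : F)
    (h : RatFunc.C a0 + RatFunc.C a1 * RatFunc.X + RatFunc.C a2 * RatFunc.X ^ 2
      + RatFunc.C a3 * RatFunc.X ^ 3 = (0 : RatFunc F)) : a0 = 0 ∧ a1 = 0 ∧ a2 = 0 ∧ a3 = 0 := by
  have h2 : algebraMap (Polynomial F) (RatFunc F) (Polynomial.C a0 + Polynomial.C a1 * Polynomial.X
      + Polynomial.C a2 * Polynomial.X ^ 2 + Polynomial.C a3 * Polynomial.X ^ 3) = 0 := by
    simpa [RatFunc.algebraMap_C, RatFunc.algebraMap_X] using h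
  have h3 := (map_eq_zero_iff _ (RatFunc.algebraMap_injective F)).1 h2
  have c0 := congrArg (fun P => P.coeff 0) h3
  have c1 := congrArg (fun P => P.coeff 1) h3
  have c2 := congrArg (fun P => P.coeff 2) h3
  have c3 := congrArg (fun P => P.coeff 3) h3
  simp [Polynomial.coeff_X, Polynomial.coeff_X_pow] at c0 c1 c2 c3
  exact ⟨c0, c1, c2, c3⟩

noncomputable def Phi1 (q : F × F × F) : RatFunc F × RatFunc F × RatFunc F :=
  (RatFunc.X * RatFunc.C q.1 + 1, RatFunc.X ^ 2 * RatFunc.C q.2.1,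
    RatFunc.C q.2.2 + RatFunc.X * RatFunc.C q.1 + 1)

noncomputable def Phi2 (q : F × F × F) : RatFunc F × RatFunc F × RatFunc F :=
  (RatFunc.C q.1 / RatFunc.X ^ 2, RatFunc.C q.2.1 / RatFunc.X + 1,
    RatFunc.C q.2.2 - RatFunc.C q.2.1 / RatFunc.X)

lemma rX_ne : (RatFunc.X : RatFunc F) ≠ 0 := RatFunc.X_ne_zero

lemma Phi1_rel (q q' : F × F × F) (h : (Phi1 q).2.2 - (Phi1 q').2.2 =
    (Phi1 q).1 * (Phi1 q').2.1 - (Phi1 q').1 * (Phi1 q).2.1) : q = q' := by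
  simp only [Phi1] at h
  have := ratfunc_indep (q.2.2 - q'.2.2) (q.1 - q'.1) (q.2.1 - q'.2.1) (q'.1 * q.2.1 - q.1 * q'.2.1) (by
    simp only [map_sub, map_mul]
    linear_combination h)
  exact Prod.ext (sub_eq_zero.1 this.2.1) (Prod.ext (sub_eq_zero.1 this.2.2.1) (sub_eq_zero.1 this.1))

lemma Phi2_rel (q q' : F × F × F) (h : (Phi2 q).2.2 - (Phi2 q').2.2 =
    (Phi2 q).1 * (Phi2 q').2.1 - (Phi2 q').1 * (Phi2 q).2.1) : q = q' := by
  simp only [Phi2] at h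
  have hX := rX_ne (F := F)
  have := ratfunc_indep (q'.1 * q.2.1 - q.1 * q'.2.1) (q'.1 - q.1) (q'.2.1 - q.2.1) (q.2.2 - q'.2.2) (by
    simp only [map_sub, map_mul]
    field_simp at h
    linear_combination h)
  exact Prod.ext (sub_eq_zero.1 this.2.1).symm (Prod.ext (sub_eq_zero.1 this.2.2.1).symm (sub_eq_zero.1 this.2.2.2))

lemma Phi_meet (q q' : F × F × F) (h : q.2.2 - q'.2.2 = q.1 * q'.2.1 - q'.1 * q.2.1) :
    meet (Phi1 q) (Phi2 q') := by
  have hX := rX_ne (F := F)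
  constructor
  · intro hz
    simp only [Phi1, Phi2] at hz
    have := ratfunc_indep (-q'.1) 0 1 q.1 (by
      field_simp at hz
      simp only [map_neg, map_zero, map_one]
      linear_combination hz)
    exact one_ne_zero this.2.2.1
  · simp only [Phi1, Phi2]
    have h2 := congrArg (RatFunc.C (K := F)) h
    simp only [map_sub, map_mul] at h2
    field_simp
    linear_combination RatFunc.X * h2

lemma log_cube (L : ℕ) : (1 + L) ^ 3 ≤ 8 * 2 ^ L := by
  rcases lt_or_ge L 4 with h | h
  · interval_cases L <;> norm_num
  · induction L, h using Nat.le_induction with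
    | base => norm_num
    | succ n hn ih =>
      rw [pow_succ 2 n]
      have : (1 + (n + 1)) ^ 3 ≤ 2 * (1 + n) ^ 3 := by nlinarith [Nat.mul_le_mul hn hn, Nat.mul_le_mul hn (Nat.mul_le_mul hn hn)]
      omega

lemma s_bound (n : ℕ) (hn : 1 ≤ n) : ∃ s, n ≤ s ^ 2 ∧ s ^ 2 ≤ 2 * n ∧ 1 ≤ s ∧ ∀ p, n ≤ p ^ 2 → s ≤ p := by
  obtain ⟨a, ha⟩ : ∃ a, a = Nat.sqrt (n - 1) := ⟨_, rfl⟩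
  have h1 : a ^ 2 ≤ n - 1 := by rw [ha]; exact Nat.sqrt_le' _
  have h2 : n - 1 < (a + 1) ^ 2 := by rw [ha]; exact Nat.lt_succ_sqrt' _
  refine ⟨a + 1, by omega, ?_, by omega, ?_⟩
  · have : 2 * a ≤ a ^ 2 + 1 := by zify; nlinarith [sq_nonneg ((a:ℤ) - 1)]
    have e : (a + 1) ^ 2 = a ^ 2 + 2 * a + 1 := by ring
    omega
  · intro p hp
    by_contra hlt
    have : p ^ 2 ≤ a ^ 2 := Nat.pow_le_pow_left (by omega) 2
    omega

theorem expander (p : ℕ) [Fact p.Prime] (A B : Finset (ZMod p)) (α : ZMod p) (hα : α ≠ 0)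
    (φ ψ : ZMod p → ZMod p) (hA : A.card ≤ B.card) (hA1 : 1 ≤ A.card) (hn : A.card ^ 2 * B.card ≤ p ^ 2) :
    A.card ^ 2 * B.card ≤ 8 * 186626 ^ 2 * ((B ×ˢ A ×ˢ A).image
      (fun x => x.1 + α * x.2.1 * x.2.2 + φ x.2.1 + ψ x.2.2)).card ^ 2 := by
  classical
  let K := RatFunc (ZMod p)
  haveI : CharP (RatFunc (ZMod p)) p :=
    charP_of_injective_algebraMap (algebraMap (ZMod p) (RatFunc (ZMod p))).injective p
  set T := B ×ˢ A ×ˢ A with hT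
  set v : ZMod p × ZMod p × ZMod p → ZMod p := fun x => x.1 + α * x.2.1 * x.2.2 + φ x.2.1 + ψ x.2.2 with hv
  set S := T.image v with hS
  have hTc : T.card = A.card ^ 2 * B.card := by
    rw [hT, Finset.card_product, Finset.card_product]; ring
  obtain ⟨n, hnd⟩ : ∃ n, n = A.card ^ 2 * B.card := ⟨_, rfl⟩
  rw [← hnd] at hn hTc ⊢
  have hn1 : 1 ≤ n := by
    rw [hnd]
    have : 1 ≤ A.card ^ 2 := Nat.one_le_pow _ _ hA1
    exact Nat.mul_pos this (by omega)
  obtain ⟨s, hs1, hs2, hs3, hsp⟩ := s_bound n hn1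
  -- energy
  let En := (T ×ˢ T).filter (fun y => v y.1 = v y.2)
  have hCS : n ^ 2 ≤ S.card * En.card := by
    have h1 : ∑ c ∈ S, (T.filter fun x => v x = c).card = n := by
      rw [← hTc]
      exact (Finset.card_eq_sum_card_image v T).symm
    have h2 : En.card = ∑ c ∈ S, (T.filter fun x => v x = c).card ^ 2 := by
      rw [Finset.card_eq_sum_card_fiberwise (f := fun y => v y.1) (t := S)]
      · refine Finset.sum_congr rfl fun c _ => ?_
        rw [pow_two, ← Finset.card_product]
        congr 1
        ext ⟨x, y⟩
        simp only [En, Finset.mem_filter, Finset.mem_product]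
        constructor
        · rintro ⟨⟨⟨hx, hy⟩, h⟩, h'⟩
          exact ⟨⟨hx, h'⟩, hy, h ▸ h'⟩
        · rintro ⟨⟨hx, h⟩, hy, h'⟩
          exact ⟨⟨⟨hx, hy⟩, h.trans h'.symm⟩, h⟩
      · intro y hy
        simp only [En, Finset.coe_filter, Finset.mem_product, Set.mem_setOf_eq] at hy
        exact Finset.mem_coe.2 (Finset.mem_image_of_mem _ hy.1.1)
    rw [← h1, h2]
    exact sq_sum_le_card_mul_sum_sq
  let κ : ZMod p × ZMod p × ZMod p → ZMod p × ZMod p × ZMod p :=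
    fun x => (α * x.2.1, -x.2.2, x.1 + φ x.2.1 - ψ x.2.2)
  have κinj : Function.Injective κ := by
    rintro ⟨b, z, t⟩ ⟨b', z', t'⟩ h
    simp only [κ, Prod.mk.injEq] at h
    have hz : z = z' := mul_left_cancel₀ hα h.1
    have ht : t = t' := neg_injective h.2.1
    subst hz ht
    have hb : b = b' := by linear_combination h.2.2
    rw [hb]
  let P1 := T.image (fun x => Phi1 (κ x))
  let P2 := T.image (fun x => Phi2 (κ x))
  have sk1 : Skew P1 := by
    intro q hq q' hq' h
    obtain ⟨x, hx, rfl⟩ := Finset.mem_image.1 hq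
    obtain ⟨x', hx', rfl⟩ := Finset.mem_image.1 hq'
    rw [Phi1_rel _ _ h]
  have sk2 : Skew P2 := by
    intro q hq q' hq' h
    obtain ⟨x, hx, rfl⟩ := Finset.mem_image.1 hq
    obtain ⟨x', hx', rfl⟩ := Finset.mem_image.1 hq'
    rw [Phi2_rel _ _ h]
  have c1 : P1.card ≤ n := Finset.card_image_le.trans hTc.le
  have c2 : P2.card ≤ n := Finset.card_image_le.trans hTc.le
  have hk1 : (P2.image fun q => q.1).card ≤ A.card := by
    have : (P2.image fun q => q.1) ⊆ A.image (fun z => (RatFunc.C (α * z) / RatFunc.X ^ 2 : RatFunc (ZMod p))) := by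
      intro y hy
      simp only [P2, Finset.mem_image, exists_exists_and_eq_and] at hy
      obtain ⟨x, hx, rfl⟩ := hy
      simp only [hT, Finset.mem_product] at hx
      exact Finset.mem_image.2 ⟨x.2.1, hx.2.1, rfl⟩
    exact (Finset.card_le_card this).trans Finset.card_image_le
  have hk2 : (P2.image fun q => q.2.1).card ≤ A.card := by
    have : (P2.image fun q => q.2.1) ⊆ A.image (fun t => (RatFunc.C (-t) / RatFunc.X + 1 : RatFunc (ZMod p))) := by
      intro y hy
      simp only [P2, Finset.mem_image, exists_exists_and_eq_and] at hy
      obtain ⟨x, hx, rfl⟩ := hy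
      simp only [hT, Finset.mem_product] at hx
      exact Finset.mem_image.2 ⟨x.2.2, hx.2.2, rfl⟩
    exact (Finset.card_le_card this).trans Finset.card_image_le
  have hinc := main_inc (p := p) s (hsp p hn) A.card P1 P2 sk1 sk2 (c1.trans hs1) (c2.trans hs1) hk1 hk2
  have Phi1inj : Function.Injective (Phi1 (F := ZMod p)) := by
    intro q q' h
    apply Phi1_rel
    rw [h]; ring
  have Phi2inj : Function.Injective (Phi2 (F := ZMod p)) := by
    intro q q' h
    apply Phi2_rel
    rw [h]; ring
  have hE : En.card ≤ inc P1 P2 := by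
    rw [inc_eq_card]
    apply Finset.card_le_card_of_injOn (fun y : (ZMod p × ZMod p × ZMod p) × (ZMod p × ZMod p × ZMod p) =>
      (Phi1 (κ (y.1.1, y.1.2.1, y.2.2.2)), Phi2 (κ (y.2.1, y.2.2.1, y.1.2.2))))
    · rintro ⟨⟨b, z, t⟩, ⟨b', z', t'⟩⟩ hy
      simp only [En, hT, Finset.coe_filter, Finset.mem_product, Set.mem_setOf_eq] at hy
      obtain ⟨⟨⟨hb, hz, ht⟩, hb', hz', ht'⟩, hvv⟩ := hy
      simp only [Finset.coe_filter, Finset.mem_product, Set.mem_setOf_eq]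
      refine ⟨⟨Finset.mem_image.2 ⟨(b, z, t'), by simp [hT, *], rfl⟩,
        Finset.mem_image.2 ⟨(b', z', t), by simp [hT, *], rfl⟩⟩, ?_⟩
      apply Phi_meet
      simp only [κ]
      simp only [hv] at hvv
      linear_combination hvv
    · rintro ⟨⟨b, z, t⟩, ⟨b', z', t'⟩⟩ _ ⟨⟨c, y, u⟩, ⟨c', y', u'⟩⟩ _ h
      simp only [Prod.mk.injEq] at h
      have h1 := κinj (Phi1inj h.1)
      have h2 := κinj (Phi2inj h.2)
      simp only [Prod.mk.injEq] at h1 h2 ⊢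
      tauto
  -- arithmetic
  have hN3 : A.card ^ 3 ≤ s ^ 2 := by
    refine le_trans ?_ hs1
    rw [hnd, pow_succ]
    exact Nat.mul_le_mul_left _ hA
  have hNl : A.card * (1 + Nat.log 2 s) ≤ 2 * s := by
    have h1 := log_cube (Nat.log 2 s)
    have h2 : 2 ^ Nat.log 2 s ≤ s := Nat.pow_log_le_self 2 (by omega)
    have h3 : (A.card * (1 + Nat.log 2 s)) ^ 3 ≤ (2 * s) ^ 3 := by
      calc (A.card * (1 + Nat.log 2 s)) ^ 3 = A.card ^ 3 * (1 + Nat.log 2 s) ^ 3 := by ring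
        _ ≤ s ^ 2 * (8 * s) := Nat.mul_le_mul hN3 (h1.trans (by omega))
        _ = _ := by ring
    exact (Nat.pow_le_pow_iff_left (by norm_num)).1 h3
  have hE2 : En.card ≤ 186626 * s ^ 3 := by
    have : A.card * P1.card * (1 + Nat.log 2 s) ≤ 2 * s ^ 3 := by
      calc A.card * P1.card * (1 + Nat.log 2 s) = (A.card * (1 + Nat.log 2 s)) * P1.card := by ring
        _ ≤ (2 * s) * s ^ 2 := Nat.mul_le_mul hNl (c1.trans hs1)
        _ = _ := by ring
    omega
  have hfin : n ^ 2 ≤ S.card * (186626 * s ^ 3) := hCS.trans (Nat.mul_le_mul_left _ hE2)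
  have h4 : n ^ 3 * n ≤ n ^ 3 * (8 * 186626 ^ 2 * S.card ^ 2) := by
    calc n ^ 3 * n = (n ^ 2) ^ 2 := by ring
      _ ≤ (S.card * (186626 * s ^ 3)) ^ 2 := Nat.pow_le_pow_left hfin 2
      _ = 186626 ^ 2 * S.card ^ 2 * (s ^ 2) ^ 3 := by ring
      _ ≤ 186626 ^ 2 * S.card ^ 2 * (2 * n) ^ 3 := Nat.mul_le_mul_left _ (Nat.pow_le_pow_left hs2 3)
      _ = _ := by ring
  exact Nat.le_of_mul_le_mul_left h4 (by positivity)

end PartFive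

section PartSix

lemma decomp {F : Type*} [Field F] (g : MvPolynomial (Fin 2) F) (hg : g.totalDegree = 2)
    (hc : MvPolynomial.coeff (Finsupp.single 0 1 + Finsupp.single 1 1) g ≠ 0) :
    ∃ φ ψ : F → F, ∀ z t, MvPolynomial.eval ![z, t] g =
      MvPolynomial.coeff (Finsupp.single 0 1 + Finsupp.single 1 1) g * z * t + φ z + ψ t := by
  classical
  set e : Fin 2 →₀ ℕ := Finsupp.single 0 1 + Finsupp.single 1 1 with he
  have e0 : e 0 = 1 := by simp [he]
  have e1 : e 1 = 1 := by simp [he]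
  refine ⟨fun z => ∑ m ∈ g.support.filter (fun m => m 1 = 0), MvPolynomial.coeff m g * z ^ m 0,
    fun t => ∑ m ∈ (g.support.filter (fun m => ¬ m 1 = 0)).filter (fun m => m 0 = 0),
      MvPolynomial.coeff m g * t ^ m 1, fun z t => ?_⟩
  rw [MvPolynomial.eval_eq', ← Finset.sum_filter_add_sum_filter_not g.support (fun m => m 1 = 0),
    ← Finset.sum_filter_add_sum_filter_not (g.support.filter (fun m => ¬ m 1 = 0)) (fun m => m 0 = 0)]
  have h1 : ∑ m ∈ g.support.filter (fun m => m 1 = 0), MvPolynomial.coeff m g * ∏ i, ![z, t] i ^ m i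
      = ∑ m ∈ g.support.filter (fun m => m 1 = 0), MvPolynomial.coeff m g * z ^ m 0 := by
    refine Finset.sum_congr rfl fun m hm => ?_
    rw [Fin.prod_univ_two]
    simp [(Finset.mem_filter.1 hm).2]
  have h2 : ∑ m ∈ (g.support.filter (fun m => ¬ m 1 = 0)).filter (fun m => m 0 = 0),
        MvPolynomial.coeff m g * ∏ i, ![z, t] i ^ m i
      = ∑ m ∈ (g.support.filter (fun m => ¬ m 1 = 0)).filter (fun m => m 0 = 0),
        MvPolynomial.coeff m g * t ^ m 1 := by
    refine Finset.sum_congr rfl fun m hm => ?_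
    rw [Fin.prod_univ_two]
    simp [(Finset.mem_filter.1 hm).2]
  have h3 : (g.support.filter (fun m => ¬ m 1 = 0)).filter (fun m => ¬ m 0 = 0) = {e} := by
    ext m
    simp only [Finset.mem_filter, Finset.mem_singleton]
    constructor
    · rintro ⟨⟨hm, hm1⟩, hm0⟩
      have := MvPolynomial.le_totalDegree hm
      rw [hg, Finsupp.sum_fintype _ _ (by simp), Fin.sum_univ_two] at this
      ext i
      fin_cases i
      · simp only [Fin.zero_eta]; rw [e0]; omega
      · simp only [Fin.mk_one]; rw [e1]; omega
    · rintro rfl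
      exact ⟨⟨MvPolynomial.mem_support_iff.2 hc, by omega⟩, by omega⟩
  rw [h1, h2, h3, Finset.sum_singleton, Fin.prod_univ_two, e0, e1]
  simp
  ring

lemma pow_injOn (p : ℕ) [Fact p.Prime] (h : (ZMod p)ˣ) (hh : ∀ u : (ZMod p)ˣ, u ∈ Subgroup.zpowers h)
    (N : ℕ) (hN : N < p) : Set.InjOn (fun i => (h : ZMod p) ^ i) (Set.Icc 1 N) := by
  intro i hi j hj hij
  simp only at hij
  have ho : orderOf h = p - 1 := by
    rw [orderOf_eq_card_of_forall_mem_zpowers hh, Nat.card_eq_fintype_card, ZMod.card_units]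
  have h2 : h ^ i = h ^ j := by
    apply Units.ext; push_cast; exact hij
  rw [pow_inj_mod, ho] at h2
  have hi1 := hi.1
  have hi2 := hi.2
  have hj1 := hj.1
  have hj2 := hj.2
  -- both lie in `[1, p-1]`
  rcases eq_or_lt_of_le (show i ≤ p - 1 by omega) with a | a <;>
    rcases eq_or_lt_of_le (show j ≤ p - 1 by omega) with b | b
  · omega
  · rw [a, Nat.mod_self, Nat.mod_eq_of_lt b] at h2; omega
  · rw [b, Nat.mod_self, Nat.mod_eq_of_lt a] at h2; omega
  · rwa [Nat.mod_eq_of_lt a, Nat.mod_eq_of_lt b] at h2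

lemma final_nat (p : ℕ) [Fact p.Prime] (h : (ZMod p)ˣ) (hh : ∀ u : (ZMod p)ˣ, u ∈ Subgroup.zpowers h)
    (g : MvPolynomial (Fin 2) (ZMod p)) (hg : g.totalDegree = 2)
    (hc : MvPolynomial.coeff (Finsupp.single 0 1 + Finsupp.single 1 1) g ≠ 0)
    (N : ℕ) (hN1 : 1 ≤ N) (hN : N ^ 7 ≤ p ^ 4) :
    N ^ 7 ≤ (3 * (8 * 186626 ^ 2) * ((((Finset.Icc 1 N ×ˢ Finset.Icc 1 N) ×ˢ (Finset.Icc 1 N ×ˢ Finset.Icc 1 N))).image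
          (fun q => (h : ZMod p) ^ q.1.1 + (h : ZMod p) ^ q.1.2 +
            MvPolynomial.eval ![(h : ZMod p) ^ q.2.1, (h : ZMod p) ^ q.2.2] g)).card) ^ 4 := by
  classical
  have hp1 : 1 < p := (Fact.out : p.Prime).one_lt
  have hNp : N < p := by
    by_contra hlt
    have h1 : p ^ 7 ≤ N ^ 7 := Nat.pow_le_pow_left (by omega) 7
    have h2 : p ^ 4 < p ^ 7 := Nat.pow_lt_pow_right hp1 (by norm_num)
    omega
  have hinj := pow_injOn p h hh N hNp
  let P : ℕ → Finset (ZMod p) := fun M => (Finset.Icc 1 M).image (fun i => (h : ZMod p) ^ i)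
  have hP : ∀ M, M ≤ N → (P M).card = M := by
    intro M hM
    rw [Finset.card_image_of_injOn, Nat.card_Icc, Nat.add_sub_cancel]
    apply hinj.mono
    intro i hi
    simp only [Finset.coe_Icc, Set.mem_Icc] at hi ⊢
    omega
  have hPN := hP N le_rfl
  let AA := (P N ×ˢ P N).image (fun x => x.1 + x.2)
  have memP : ∀ i, 1 ≤ i → i ≤ N → (h : ZMod p) ^ i ∈ P N := fun i h1 h2 =>
    Finset.mem_image.2 ⟨i, Finset.mem_Icc.2 ⟨h1, h2⟩, rfl⟩
  obtain ⟨c, hcd⟩ : ∃ c, c = 8 * 186626 ^ 2 := ⟨_, rfl⟩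
  have hN3 : N ^ 3 ≤ p ^ 2 := by
    have h1 : (N ^ 3) ^ 2 ≤ (p ^ 2) ^ 2 := by
      calc (N ^ 3) ^ 2 = N ^ 6 := by ring
        _ ≤ N ^ 7 := Nat.pow_le_pow_right hN1 (by norm_num)
        _ ≤ p ^ 4 := hN
        _ = _ := by ring
    exact (Nat.pow_le_pow_iff_left (by norm_num)).1 h1
  have hAN : N ≤ AA.card := by
    rw [← hPN]
    apply Finset.card_le_card_of_injOn (fun x => x + (h : ZMod p) ^ 1)
    · intro x hx
      exact Finset.mem_coe.2 (Finset.mem_image.2 ⟨(x, (h : ZMod p) ^ 1), Finset.mem_product.2 ⟨hx, memP 1 le_rfl hN1⟩, rfl⟩)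
    · intro x _ y _ hxy
      exact add_right_cancel hxy
  -- step one: sumset
  have step1 : N ^ 3 ≤ 9 * c * AA.card ^ 2 := by
    rcases Nat.lt_or_ge N 2 with h2 | h2
    · have : N = 1 := by omega
      subst this
      have : 1 ≤ AA.card ^ 2 := Nat.one_le_pow _ _ hAN
      rw [hcd]; omega
    · obtain ⟨M, hM⟩ : ∃ M, M = N / 2 := ⟨_, rfl⟩
      have hPM := hP M (by omega)
      have hE := expander p (P M) (P N) 1 one_ne_zero (fun _ => 0) (fun _ => 0)
        (by rw [hPM, hPN]; omega) (by rw [hPM]; omega) (by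
          rw [hPM, hPN]
          refine le_trans ?_ hN3
          rw [pow_succ N 2]
          exact Nat.mul_le_mul_right _ (Nat.pow_le_pow_left (by omega) 2))
      rw [hPM, hPN, ← hcd] at hE
      have hsub : ((P N ×ˢ P M ×ˢ P M).image
          (fun x => x.1 + 1 * x.2.1 * x.2.2 + (fun _ => 0) x.2.1 + (fun _ => 0) x.2.2)) ⊆ AA := by
        intro y hy
        obtain ⟨⟨b, z, t⟩, hx, rfl⟩ := Finset.mem_image.1 hy
        simp only [Finset.mem_product] at hx
        obtain ⟨hb, hz, ht⟩ := hx
        obtain ⟨i, hi, rfl⟩ := Finset.mem_image.1 hz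
        obtain ⟨j, hj, rfl⟩ := Finset.mem_image.1 ht
        rw [Finset.mem_Icc] at hi hj
        refine Finset.mem_image.2 ⟨(b, (h : ZMod p) ^ (i + j)), Finset.mem_product.2 ⟨hb, memP _ (by omega) (by omega)⟩, ?_⟩
        simp only [pow_add]; ring
      have h3 := hE.trans (Nat.mul_le_mul_left c (Nat.pow_le_pow_left (Finset.card_le_card hsub) 2))
      have h4 : N ^ 2 ≤ 9 * M ^ 2 := by
        have := Nat.pow_le_pow_left (show N ≤ 3 * M by omega) 2
        rw [mul_pow] at this; omega
      calc N ^ 3 = N ^ 2 * N := by ring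
        _ ≤ 9 * M ^ 2 * N := Nat.mul_le_mul_right _ h4
        _ = 9 * (M ^ 2 * N) := by ring
        _ ≤ 9 * (c * AA.card ^ 2) := Nat.mul_le_mul_left _ h3
        _ = _ := by ring
  -- step two
  obtain ⟨r, hr⟩ : ∃ r, r = Nat.sqrt (N ^ 3) := ⟨_, rfl⟩
  have hr1 : r ^ 2 ≤ N ^ 3 := by rw [hr]; exact Nat.sqrt_le' _
  have hr2 : N ^ 3 < (r + 1) ^ 2 := by rw [hr]; exact Nat.lt_succ_sqrt' _
  have hNr : N ≤ r := by
    rw [hr, Nat.le_sqrt']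
    exact Nat.pow_le_pow_right hN1 (by norm_num)
  have hr3 : N ^ 3 ≤ 9 * c * r ^ 2 := by
    have h1 : (r + 1) ^ 2 ≤ (2 * r) ^ 2 := Nat.pow_le_pow_left (by omega) 2
    rw [mul_pow] at h1
    have h2 : 2 ^ 2 * r ^ 2 ≤ 9 * c * r ^ 2 := Nat.mul_le_mul_right _ (by rw [hcd]; norm_num)
    omega
  obtain ⟨B, hBA, hB⟩ := Finset.exists_subset_card_eq (s := AA) (n := min r AA.card) (min_le_right _ _)
  obtain ⟨m, hm⟩ : ∃ m, m = min r AA.card := ⟨_, rfl⟩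
  rw [← hm] at hB
  have hmN : N ≤ m := by rw [hm]; exact le_min hNr hAN
  have hmr : m ≤ r := by rw [hm]; exact min_le_left _ _
  have hm3 : N ^ 3 ≤ 9 * c * m ^ 2 := by
    rcases min_choice r AA.card with h1 | h1
    · rw [hm, h1]; exact hr3
    · rw [hm, h1]; exact step1
  have hmp : N ^ 2 * m ≤ p ^ 2 := by
    have h1 : (N ^ 2 * m) ^ 2 ≤ (p ^ 2) ^ 2 := by
      calc (N ^ 2 * m) ^ 2 = N ^ 4 * m ^ 2 := by ring
        _ ≤ N ^ 4 * N ^ 3 := Nat.mul_le_mul_left _ ((Nat.pow_le_pow_left hmr 2).trans hr1)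
        _ = N ^ 7 := by ring
        _ ≤ p ^ 4 := hN
        _ = _ := by ring
    exact (Nat.pow_le_pow_iff_left (by norm_num)).1 h1
  obtain ⟨φ, ψ, hφ⟩ := decomp g hg hc
  have hE := expander p (P N) B _ hc φ ψ (by rw [hPN, hB]; exact hmN) (by rw [hPN]; exact hN1)
    (by rw [hPN, hB]; exact hmp)
  rw [hPN, hB, ← hcd] at hE
  rw [← hcd]
  set S := ((((Finset.Icc 1 N ×ˢ Finset.Icc 1 N) ×ˢ (Finset.Icc 1 N ×ˢ Finset.Icc 1 N))).image
          (fun q => (h : ZMod p) ^ q.1.1 + (h : ZMod p) ^ q.1.2 +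
            MvPolynomial.eval ![(h : ZMod p) ^ q.2.1, (h : ZMod p) ^ q.2.2] g)) with hS
  have hsub : (B ×ˢ P N ×ˢ P N).image (fun x => x.1 +
      MvPolynomial.coeff (Finsupp.single 0 1 + Finsupp.single 1 1) g * x.2.1 * x.2.2 + φ x.2.1 + ψ x.2.2) ⊆ S := by
    intro y hy
    obtain ⟨⟨b, z, t⟩, hx, rfl⟩ := Finset.mem_image.1 hy
    simp only [Finset.mem_product] at hx
    obtain ⟨hb, hz, ht⟩ := hx
    obtain ⟨⟨b1, b2⟩, hbb, rfl⟩ := Finset.mem_image.1 (hBA hb)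
    obtain ⟨hb1, hb2⟩ := Finset.mem_product.1 hbb
    obtain ⟨i, hi, rfl⟩ := Finset.mem_image.1 hz
    obtain ⟨j, hj, rfl⟩ := Finset.mem_image.1 ht
    obtain ⟨k, hk, hk'⟩ := Finset.mem_image.1 hb1
    obtain ⟨l, hl, hl'⟩ := Finset.mem_image.1 hb2
    simp only at hk' hl'
    refine Finset.mem_image.2 ⟨((k, l), (i, j)), ?_, ?_⟩
    · simp only [Finset.mem_product]; exact ⟨⟨hk, hl⟩, hi, hj⟩
    · simp only [hφ, ← hk', ← hl']; ring
  have h5 := hE.trans (Nat.mul_le_mul_left c (Nat.pow_le_pow_left (Finset.card_le_card hsub) 2))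
  have hc1 : 1 ≤ c := by rw [hcd]; norm_num
  calc N ^ 7 = N ^ 4 * N ^ 3 := by ring
    _ ≤ N ^ 4 * (9 * c * m ^ 2) := Nat.mul_le_mul_left _ hm3
    _ = 9 * c * (N ^ 2 * m) ^ 2 := by ring
    _ ≤ 9 * c * (c * S.card ^ 2) ^ 2 := Nat.mul_le_mul_left _ (Nat.pow_le_pow_left h5 2)
    _ = (c ^ 3 * S.card ^ 4) * (9 * 1) := by ring
    _ ≤ (c ^ 3 * S.card ^ 4) * (81 * c) := Nat.mul_le_mul_left _ (Nat.mul_le_mul (by norm_num) hc1)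
    _ = _ := by ring

end PartSix

theorem stmt_2 :
    ∃ c : ℝ, 0 < c ∧ ∀ (p : ℕ), p.Prime → 2 < p →
      ∀ h : (ZMod p)ˣ, (∀ u : (ZMod p)ˣ, u ∈ Subgroup.zpowers h) →
      ∀ (g : MvPolynomial (Fin 2) (ZMod p)), g.totalDegree = 2 →
        MvPolynomial.coeff (Finsupp.single 0 1 + Finsupp.single 1 1) g ≠ 0 →
      ∀ N : ℕ, 1 ≤ N → (N : ℝ) ≤ (p : ℝ) ^ ((4 : ℝ) / 7) →
      c * (N : ℝ) ^ ((7 : ℝ) / 4) ≤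
        (((((Finset.Icc 1 N ×ˢ Finset.Icc 1 N) ×ˢ (Finset.Icc 1 N ×ˢ Finset.Icc 1 N))).image
          (fun q => (h : ZMod p) ^ q.1.1 + (h : ZMod p) ^ q.1.2 +
            MvPolynomial.eval ![(h : ZMod p) ^ q.2.1, (h : ZMod p) ^ q.2.2] g)).card : ℝ) := by
  refine ⟨1 / (3 * (8 * 186626 ^ 2)), by positivity, ?_⟩
  intro p hp _ h hh g hg hc N hN1 hN
  haveI : Fact p.Prime := ⟨hp⟩
  have hN7 : N ^ 7 ≤ p ^ 4 := by
    have h1 : (N : ℝ) ^ 7 ≤ ((p : ℝ) ^ ((4 : ℝ) / 7)) ^ 7 := pow_le_pow_left₀ (by positivity) hN 7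
    rw [← Real.rpow_natCast ((p : ℝ) ^ ((4 : ℝ) / 7)) 7, ← Real.rpow_mul (by positivity)] at h1
    have e : ((4 : ℝ) / 7) * ((7 : ℕ) : ℝ) = ((4 : ℕ) : ℝ) := by norm_num
    rw [e, Real.rpow_natCast] at h1
    exact_mod_cast h1
  have hfin := final_nat p h hh g hg hc N hN1 hN7
  generalize (((((Finset.Icc 1 N ×ˢ Finset.Icc 1 N) ×ˢ (Finset.Icc 1 N ×ˢ Finset.Icc 1 N))).image
          (fun q => (h : ZMod p) ^ q.1.1 + (h : ZMod p) ^ q.1.2 +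
            MvPolynomial.eval ![(h : ZMod p) ^ q.2.1, (h : ZMod p) ^ q.2.2] g)).card) = S at hfin ⊢
  have h2 : (N : ℝ) ^ 7 ≤ (3 * (8 * 186626 ^ 2) * (S : ℝ)) ^ 4 := by exact_mod_cast hfin
  have h3 : (N : ℝ) ^ ((7 : ℝ) / 4) ≤ 3 * (8 * 186626 ^ 2) * (S : ℝ) := by
    apply le_of_pow_le_pow_left₀ (n := 4) (by norm_num) (by positivity)
    refine le_trans (le_of_eq ?_) h2
    rw [← Real.rpow_natCast ((N : ℝ) ^ ((7 : ℝ) / 4)) 4, ← Real.rpow_mul (by positivity)]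
    have e : ((7 : ℝ) / 4) * ((4 : ℕ) : ℝ) = ((7 : ℕ) : ℝ) := by norm_num
    rw [e, Real.rpow_natCast]
  rw [div_mul_eq_mul_div, one_mul, div_le_iff₀ (by positivity)]
  linarith
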